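/- arXiv:2208.13060 — 2 statements merged into one kernel-verified Lean document; each statement's English description precedes it below -/
import Mathlib

section
/- The set S_{χ₁,χ₂}(Γ₁(q₁q₂)) = {S_{χ₁,χ₂}(γ) : γ ∈ Γ₁(q₁q₂)} is an additive subgroup of ℂ contained in F_{χ₁,χ₂} which is a lattice of full rank in F_{χ₁,χ₂}: it is a finitely generated free ℤ-module of rank [F_{χ₁,χ₂} : ℚ], and its ℚ-linear span equals F_{χ₁,χ₂}. -/
open scoped BigOperators

/-- The sawtooth (first Bernoulli) function `B₁`. -/
noncomputable def sawtooth (x : ℝ) : ℝ :=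
  open scoped Classical in
  if ∃ n : ℤ, x = (n : ℝ) then 0 else x - ⌊x⌋ - 1 / 2

/-- The newform Dedekind sum `S_{χ₁,χ₂}(h,k)`. -/
noncomputable def newformDedekindSum {q₁ q₂ : ℕ} (χ₁ : DirichletCharacter ℂ q₁)
    (χ₂ : DirichletCharacter ℂ q₂) (h k : ℤ) : ℂ :=
  ∑ j ∈ Finset.range k.toNat, ∑ n ∈ Finset.range q₁,
    (starRingEnd ℂ) (χ₂ (j : ZMod q₂)) * (starRingEnd ℂ) (χ₁ (n : ZMod q₁)) *
      (sawtooth ((j : ℝ) / (k : ℝ)) : ℝ) *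
      (sawtooth ((n : ℝ) / (q₁ : ℝ) + (h : ℝ) * (j : ℝ) / (k : ℝ)) : ℝ)

/-- The newform Dedekind sum of a matrix `γ`, via its left column. -/
noncomputable def SGamma {q₁ q₂ : ℕ} (χ₁ : DirichletCharacter ℂ q₁)
    (χ₂ : DirichletCharacter ℂ q₂) (γ : Matrix.SpecialLinearGroup (Fin 2) ℤ) : ℂ :=
  if 0 < (γ : Matrix (Fin 2) (Fin 2) ℤ) 1 0 then
    newformDedekindSum χ₁ χ₂ ((γ : Matrix (Fin 2) (Fin 2) ℤ) 0 0)
      ((γ : Matrix (Fin 2) (Fin 2) ℤ) 1 0)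
  else if (γ : Matrix (Fin 2) (Fin 2) ℤ) 1 0 < 0 then
    newformDedekindSum χ₁ χ₂ (-(γ : Matrix (Fin 2) (Fin 2) ℤ) 0 0)
      (-(γ : Matrix (Fin 2) (Fin 2) ℤ) 1 0)
  else 0

/-- `F_{χ₁,χ₂}`, the smallest subfield of `ℂ` containing all values of `χ₁` and `χ₂`. -/
noncomputable def Ffield {q₁ q₂ : ℕ} (χ₁ : DirichletCharacter ℂ q₁) (χ₂ : DirichletCharacter ℂ q₂) :
    Subfield ℂ :=
  Subfield.closure (Set.range χ₁ ∪ Set.range χ₂)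

namespace NewformDedekind

/-! ### Sums of periodic functions over a period -/

theorem sum_range_eq_sum_zmod {K : ℕ} [NeZero K] (g : ℤ → ℂ) :
    ∑ n ∈ Finset.range K, g n = ∑ x : ZMod K, g (x.val : ℤ) := by
  obtain ⟨k, rfl⟩ := Nat.exists_eq_succ_of_ne_zero (NeZero.ne K)
  rw [Finset.sum_range]
  rfl

theorem sum_range_comp {K : ℕ} {g : ℤ → ℂ} (hg : ∀ a b : ℤ, a ≡ b [ZMOD K] → g a = g b)
    {u : ℤ} (hu : IsCoprime u K) (t : ℤ) :
    ∑ n ∈ Finset.range K, g (u * n + t) = ∑ n ∈ Finset.range K, g n := by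
  rcases Nat.eq_zero_or_pos K with rfl | hK
  · simp
  have : NeZero K := ⟨hK.ne'⟩
  rw [sum_range_eq_sum_zmod (fun n => g (u * n + t)), sum_range_eq_sum_zmod g]
  have hunit : IsUnit (u : ZMod K) := by
    obtain ⟨a, b, hab⟩ := hu
    refine IsUnit.of_mul_eq_one (a : ZMod K) ?_
    have := congrArg (fun z : ℤ => (z : ZMod K)) hab
    push_cast at this
    rw [ZMod.natCast_self, mul_zero, add_zero] at this
    rw [mul_comm, this]
  obtain ⟨w, hw⟩ := hunit
  refine Fintype.sum_equiv ((Units.mulLeft w).trans (Equiv.addRight (t : ZMod K))) _ _ ?_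
  intro x
  apply hg
  rw [← ZMod.intCast_eq_intCast_iff]
  simp [hw]

theorem sum_range_mul_add (k l : ℕ) (g : ℕ → ℂ) :
    ∑ j ∈ Finset.range (k * l), g j =
      ∑ j ∈ Finset.range k, ∑ i ∈ Finset.range l, g (j + k * i) := by
  rw [Finset.sum_comm]
  induction l with
  | zero => simp
  | succ l ih =>
    rw [mul_add_one, Finset.sum_range_add, ih, Finset.sum_range_succ]
    congr 1
    exact Finset.sum_congr rfl fun _ _ => by rw [add_comm]

theorem sum_range_mul_of_periodic {k : ℕ} (l : ℕ) {g : ℤ → ℂ}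
    (hg : ∀ a b : ℤ, a ≡ b [ZMOD k] → g a = g b) :
    ∑ j ∈ Finset.range (k * l), g j = l * ∑ j ∈ Finset.range k, g j := by
  rw [sum_range_mul_add k l fun j => g j, Finset.mul_sum]
  refine Finset.sum_congr rfl fun j _ => ?_
  have h : ∀ i : ℕ, g ((j + k * i : ℕ) : ℤ) = g j := fun i =>
    hg _ _ (Int.modEq_iff_dvd.2 ⟨-i, by push_cast; ring⟩)
  rw [Finset.sum_congr rfl fun i _ => h i]
  simp

/-! ### The sawtooth function -/

theorem sawtooth_eq (x : ℝ) : sawtooth x = (Int.fract x - Int.fract (-x)) / 2 := by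
  unfold sawtooth
  split_ifs with h
  · obtain ⟨n, rfl⟩ := h
    rw [← Int.cast_neg, Int.fract_intCast, Int.fract_intCast]; simp
  · rw [Int.fract_neg, Int.self_sub_floor]
    · ring
    · intro h0
      exact h ⟨⌊x⌋, by rw [Int.fract] at h0; linarith⟩

theorem sawtooth_neg (x : ℝ) : sawtooth (-x) = -sawtooth x := by
  rw [sawtooth_eq, sawtooth_eq, neg_neg]; ring

theorem sawtooth_add_int (x : ℝ) (n : ℤ) : sawtooth (x + n) = sawtooth x := by
  rw [sawtooth_eq, sawtooth_eq, neg_add, ← sub_eq_add_neg (-x), Int.fract_add_intCast,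
    Int.fract_sub_intCast]

theorem sawtooth_eq_of_sub {x y : ℝ} (n : ℤ) (h : x - y = n) : sawtooth x = sawtooth y := by
  rw [← sawtooth_add_int y n, ← h]; congr 1; ring

theorem sum_fract_div {m : ℕ} (hm : 0 < m) (x : ℝ) :
    ∑ i ∈ Finset.range m, Int.fract ((x + i) / m) = Int.fract x + (m - 1) / 2 := by
  have hm' : (m : ℝ) ≠ 0 := by positivity
  have h1 : ∀ i ∈ Finset.range m, Int.fract ((Int.fract x + i) / m) = (Int.fract x + i) / m := by
    intro i hi
    have hi' : (i : ℝ) + 1 ≤ m := by exact_mod_cast Finset.mem_range.1 hi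
    have h0 := Int.fract_nonneg x
    have h2 := Int.fract_lt_one x
    rw [Int.fract_eq_self]
    refine ⟨by positivity, ?_⟩
    rw [div_lt_one (by positivity)]
    linarith
  have h2 := sum_range_comp (K := m)
    (g := fun n : ℤ => ((Int.fract ((Int.fract x + n) / m) : ℝ) : ℂ)) (u := 1)
    (by
      intro a b hab
      obtain ⟨c, hc⟩ := hab.symm.dvd
      have : (Int.fract x + a) / m = (Int.fract x + b) / m + c := by
        have : (a : ℝ) = b + m * c := by exact_mod_cast (by linarith : a = b + m * c)
        rw [this]; field_simp; ring
      simp only [this, Int.fract_add_intCast])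
    isCoprime_one_left ⌊x⌋
  have h3 : ∑ i ∈ Finset.range m, Int.fract ((x + i) / m) =
      ∑ i ∈ Finset.range m, Int.fract ((Int.fract x + i) / m) := by
    have : ∀ i : ℕ, (x + i) / m = (Int.fract x + ((1 * (i : ℤ) + ⌊x⌋ : ℤ) : ℝ)) / m := by
      intro i; push_cast; congr 1; linarith [Int.fract_add_floor x]
    simp only [this]
    exact_mod_cast h2
  rw [h3, Finset.sum_congr rfl h1, ← Finset.sum_div, Finset.sum_add_distrib]
  have h4 : (∑ i ∈ Finset.range m, (i : ℝ)) * 2 = m * (m - 1) := by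
    have := Finset.sum_range_id_mul_two m
    have h5 : ((∑ i ∈ Finset.range m, i : ℕ) : ℝ) * 2 = (m : ℝ) * ((m - 1 : ℕ) : ℝ) := by
      exact_mod_cast this
    rw [Nat.cast_sub hm] at h5
    push_cast at h5
    exact h5
  rw [Finset.sum_const, Finset.card_range, nsmul_eq_mul]
  field_simp
  linarith

theorem sum_sawtooth_div {m : ℕ} (hm : 0 < m) (x : ℝ) :
    ∑ i ∈ Finset.range m, sawtooth ((x + i) / m) = sawtooth x := by
  have hm' : (m : ℝ) ≠ 0 := by positivity
  simp only [sawtooth_eq]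
  rw [← Finset.sum_div, Finset.sum_sub_distrib, sum_fract_div hm]
  have : ∑ i ∈ Finset.range m, Int.fract (-((x + i) / m)) =
      ∑ i ∈ Finset.range m, Int.fract ((-x + i) / m) := by
    rw [← Finset.sum_range_reflect]
    trans ∑ i ∈ Finset.range m, Int.fract ((-x + 1 + i) / m)
    · refine Finset.sum_congr rfl fun i hi => ?_
      have hi := Finset.mem_range.1 hi
      have : ((m - 1 - i : ℕ) : ℝ) = m - 1 - i := by
        rw [Nat.sub_sub, Nat.cast_sub (by omega)]; push_cast; ring
      rw [this, ← Int.fract_add_intCast _ 1]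
      congr 1
      push_cast
      field_simp
      ring
    · rw [sum_fract_div hm, sum_fract_div hm]
      congr 1
      exact_mod_cast Int.fract_add_intCast (-x) 1
  rw [this, sum_fract_div hm]
  ring

/-- The second periodic Bernoulli function. -/
noncomputable def bern2 (x : ℝ) : ℝ := Int.fract x ^ 2 - Int.fract x + 1 / 6

theorem bern2_eq_of_sub {x y : ℝ} (n : ℤ) (h : x - y = n) : bern2 x = bern2 y := by
  have : x = y + n := by linarith
  rw [bern2, bern2, this, Int.fract_add_intCast]

theorem bern2_neg (x : ℝ) : bern2 (-x) = bern2 x := by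
  unfold bern2
  by_cases h : Int.fract x = 0
  · rw [Int.fract_neg_eq_zero.2 h, h]
  · rw [Int.fract_neg h]; ring

theorem sawtooth_eq_fract {x : ℝ} (h : Int.fract x ≠ 0) : sawtooth x = Int.fract x - 1 / 2 := by
  rw [sawtooth_eq, Int.fract_neg h]; ring

theorem sawtooth_eq_zero {x : ℝ} (h : Int.fract x = 0) : sawtooth x = 0 := by
  rw [sawtooth_eq, Int.fract_neg_eq_zero.2 h, h]; ring

theorem sawtooth_mul_three_term (x y : ℝ) (h : Int.fract x ≠ 0 ∨ Int.fract y ≠ 0) :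
    sawtooth x * sawtooth y - sawtooth y * sawtooth (x + y) - sawtooth (x + y) * sawtooth x =
      -(bern2 x + bern2 y + bern2 (x + y)) / 2 := by
  have hx0 := Int.fract_nonneg x
  have hx1 := Int.fract_lt_one x
  have hy0 := Int.fract_nonneg y
  have hy1 := Int.fract_lt_one y
  have hxy : ∃ n : ℤ, Int.fract (x + y) = Int.fract x + Int.fract y - n := by
    refine ⟨⌊x + y⌋ - ⌊x⌋ - ⌊y⌋, ?_⟩
    simp only [Int.fract]; push_cast; ring
  obtain ⟨n, hn⟩ := hxy
  have hz0 := Int.fract_nonneg (x + y)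
  have hz1 := Int.fract_lt_one (x + y)
  have hn' : n = 0 ∨ n = 1 := by
    have h1 : (-1 : ℝ) < n := by linarith
    have h2 : (n : ℝ) < 2 := by linarith
    have h3 : (-1 : ℤ) < n := by exact_mod_cast h1
    have h4 : n < 2 := by exact_mod_cast h2
    omega
  by_cases hx : Int.fract x = 0
  · have hy : Int.fract y ≠ 0 := h.resolve_left (not_not.2 hx)
    have hz : Int.fract (x + y) = Int.fract y := by
      rcases hn' with rfl | rfl
      · rw [hn, hx]; simp
      · exfalso; push_cast at hn; linarith
    rw [sawtooth_eq_zero hx, sawtooth_eq_fract hy, sawtooth_eq_fract (hz ▸ hy), bern2, bern2,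
      bern2, hz, hx]
    ring
  · by_cases hy : Int.fract y = 0
    · have hz : Int.fract (x + y) = Int.fract x := by
        rcases hn' with rfl | rfl
        · rw [hn, hy]; simp
        · exfalso; push_cast at hn; linarith
      rw [sawtooth_eq_zero hy, sawtooth_eq_fract hx, sawtooth_eq_fract (hz ▸ hx), bern2, bern2,
        bern2, hz, hy]
      ring
    · by_cases hz : Int.fract (x + y) = 0
      · have hy' : Int.fract y = 1 - Int.fract x := by
          rcases hn' with rfl | rfl
          · exfalso
            have : Int.fract x = 0 := by push_cast at hn; linarith
            exact hx this
          · push_cast at hn; linarith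
        rw [sawtooth_eq_zero hz, sawtooth_eq_fract hx, sawtooth_eq_fract hy, bern2, bern2,
          bern2, hz, hy']
        ring
      · rw [sawtooth_eq_fract hz, sawtooth_eq_fract hx, sawtooth_eq_fract hy, bern2, bern2,
          bern2, hn]
        rcases hn' with rfl | rfl
        · push_cast; ring
        · push_cast; ring

/-! ### Means of doubly periodic functions -/

/-- `g` is periodic modulo `K` in both variables. -/
def DoublyPeriodic (K : ℕ) (g : ℤ → ℤ → ℂ) : Prop :=
  ∀ ⦃a a' b b' : ℤ⦄, a ≡ a' [ZMOD K] → b ≡ b' [ZMOD K] → g a b = g a' b'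

/-- The mean of `g` over a square of side length `K`. -/
noncomputable def pmean (K : ℕ) (g : ℤ → ℤ → ℂ) : ℂ :=
  (∑ a ∈ Finset.range K, ∑ b ∈ Finset.range K, g a b) / (K : ℂ) ^ 2

theorem pmean_congr {K : ℕ} {g h : ℤ → ℤ → ℂ} (H : ∀ a b, g a b = h a b) :
    pmean K g = pmean K h := by
  have : g = h := by ext a b; exact H a b
  rw [this]

theorem pmean_add (K : ℕ) (g h : ℤ → ℤ → ℂ) :
    pmean K (fun a b => g a b + h a b) = pmean K g + pmean K h := by
  simp only [pmean, Finset.sum_add_distrib, add_div]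

theorem pmean_const_mul (K : ℕ) (c : ℂ) (g : ℤ → ℤ → ℂ) :
    pmean K (fun a b => c * g a b) = c * pmean K g := by
  simp only [pmean, ← Finset.mul_sum, mul_div_assoc]

theorem pmean_sum {ι : Type*} (K : ℕ) (s : Finset ι) (g : ι → ℤ → ℤ → ℂ) :
    pmean K (fun a b => ∑ i ∈ s, g i a b) = ∑ i ∈ s, pmean K (g i) := by
  simp only [pmean, ← Finset.sum_div]
  rw [Finset.sum_congr rfl fun a _ => Finset.sum_comm, Finset.sum_comm]

theorem sum_sum_eq_sum_zmod {K : ℕ} [NeZero K] (g : ℤ → ℤ → ℂ) :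
    ∑ a ∈ Finset.range K, ∑ b ∈ Finset.range K, g a b =
      ∑ p : ZMod K × ZMod K, g (p.1.val : ℤ) (p.2.val : ℤ) := by
  rw [Fintype.sum_prod_type,
    sum_range_eq_sum_zmod fun a => ∑ b ∈ Finset.range K, g a b]
  exact Finset.sum_congr rfl fun x _ => sum_range_eq_sum_zmod _

theorem pmean_translate {K : ℕ} {g : ℤ → ℤ → ℂ} (hg : DoublyPeriodic K g) (s t : ℤ) :
    pmean K (fun a b => g (a + s) (b + t)) = pmean K g := by
  rcases Nat.eq_zero_or_pos K with rfl | hK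
  · simp [pmean]
  have : NeZero K := ⟨hK.ne'⟩
  unfold pmean
  rw [sum_sum_eq_sum_zmod fun a b => g (a + s) (b + t), sum_sum_eq_sum_zmod g]
  congr 1
  refine Fintype.sum_equiv ((Equiv.addRight (s : ZMod K)).prodCongr
    (Equiv.addRight (t : ZMod K))) _ _ fun x => hg ?_ ?_
  all_goals
    rw [← ZMod.intCast_eq_intCast_iff]
    simp

theorem pmean_linear {K : ℕ} {g : ℤ → ℤ → ℂ} (hg : DoublyPeriodic K g) {p q r s : ℤ}
    (hdet : p * s - q * r = 1) :
    pmean K (fun a b => g (p * a + q * b) (r * a + s * b)) = pmean K g := by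
  rcases Nat.eq_zero_or_pos K with rfl | hK
  · simp [pmean]
  have : NeZero K := ⟨hK.ne'⟩
  unfold pmean
  rw [sum_sum_eq_sum_zmod fun a b => g (p * a + q * b) (r * a + s * b), sum_sum_eq_sum_zmod g]
  congr 1
  have hdet' : (p : ZMod K) * s - q * r = 1 := by exact_mod_cast congrArg (Int.cast : ℤ → ZMod K) hdet
  let e : ZMod K × ZMod K ≃ ZMod K × ZMod K :=
    { toFun := fun x => (p * x.1 + q * x.2, r * x.1 + s * x.2)
      invFun := fun x => (s * x.1 - q * x.2, -r * x.1 + p * x.2)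
      left_inv := fun x => by
        ext
        · linear_combination x.1 * hdet'
        · linear_combination x.2 * hdet'
      right_inv := fun x => by
        ext
        · linear_combination x.1 * hdet'
        · linear_combination x.2 * hdet' }
  refine Fintype.sum_equiv e _ _ fun x => hg ?_ ?_
  all_goals
    rw [← ZMod.intCast_eq_intCast_iff]
    simp [e]

/-- The determinant of a pair of integral vectors. -/
def det₂ (u w : ℤ × ℤ) : ℤ := u.1 * w.2 - u.2 * w.1

theorem det₂_swap (u w : ℤ × ℤ) : det₂ w u = -det₂ u w := by unfold det₂; ring

theorem div_sub_div_int {x y d : ℤ} (h : x ≡ y [ZMOD d]) :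
    ∃ n : ℤ, (x : ℝ) / d - (y : ℝ) / d = n := by
  obtain ⟨c, hc⟩ := h.symm.dvd
  rcases eq_or_ne d 0 with rfl | hd
  · exact ⟨0, by simp⟩
  · refine ⟨c, ?_⟩
    have : (d : ℝ) ≠ 0 := by exact_mod_cast hd
    have h1 : (x : ℝ) - y = d * c := by exact_mod_cast hc
    field_simp
    exact h1

theorem sawtooth_div_congr {x y d : ℤ} (h : x ≡ y [ZMOD d]) :
    sawtooth ((x : ℝ) / d) = sawtooth ((y : ℝ) / d) :=
  (div_sub_div_int h).elim sawtooth_eq_of_sub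

theorem bern2_div_congr {x y d : ℤ} (h : x ≡ y [ZMOD d]) :
    bern2 ((x : ℝ) / d) = bern2 ((y : ℝ) / d) :=
  (div_sub_div_int h).elim bern2_eq_of_sub

theorem det₂_modEq {K : ℕ} {a a' b b' : ℤ} (ha : a ≡ a' [ZMOD K]) (hb : b ≡ b' [ZMOD K])
    (w : ℤ × ℤ) : det₂ (a, b) w ≡ det₂ (a', b') w [ZMOD K] :=
  (ha.mul_right _).sub (hb.mul_right _)

/-- The Dedekind modular symbol attached to the weight `f` and the pair of directions `u`, `w`. -/
noncomputable def dedekindSymbol (f : ℤ → ℤ → ℂ) (K : ℕ) (u w : ℤ × ℤ) : ℂ :=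
  det₂ u w * pmean K fun a b =>
    f a b * (sawtooth ((det₂ (a, b) w : ℝ) / det₂ u w) : ℂ) *
      (sawtooth ((det₂ u (a, b) : ℝ) / det₂ u w) : ℂ)

theorem dedekindSymbol_swap (f : ℤ → ℤ → ℂ) (K : ℕ) (u w : ℤ × ℤ) :
    dedekindSymbol f K w u = -dedekindSymbol f K u w := by
  unfold dedekindSymbol
  rw [det₂_swap u w]
  simp only [fun a b : ℤ => det₂_swap u (a, b), fun a b : ℤ => det₂_swap (a, b) w]
  push_cast
  simp only [neg_div_neg_eq]
  rw [neg_mul]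
  congr 2
  exact pmean_congr fun a b => by ring

theorem dedekindSymbol_neg_left (f : ℤ → ℤ → ℂ) (K : ℕ) (u w : ℤ × ℤ) :
    dedekindSymbol f K (-u) w = dedekindSymbol f K u w := by
  have h : ∀ v : ℤ × ℤ, det₂ (-u) v = -det₂ u v := fun v => by
    simp only [det₂, Prod.fst_neg, Prod.snd_neg]; ring
  unfold dedekindSymbol
  simp only [h]
  push_cast
  simp only [neg_div, div_neg, neg_neg, sawtooth_neg]
  rw [neg_mul, ← mul_neg, ← neg_one_mul (pmean _ _), ← pmean_const_mul]
  congr 1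
  exact pmean_congr fun a b => by push_cast; ring

theorem dedekindSymbol_neg_right (f : ℤ → ℤ → ℂ) (K : ℕ) (u w : ℤ × ℤ) :
    dedekindSymbol f K u (-w) = dedekindSymbol f K u w := by
  rw [dedekindSymbol_swap f K (-w) u, dedekindSymbol_neg_left, ← dedekindSymbol_swap]

theorem dedekindSymbol_eq_zero {f : ℤ → ℤ → ℂ} {K : ℕ} {u w : ℤ × ℤ} (h : det₂ u w = 0) :
    dedekindSymbol f K u w = 0 := by
  simp [dedekindSymbol, h]

/-- `f` is invariant under translation by integral multiples of `u`. -/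
def InvariantUnder (f : ℤ → ℤ → ℂ) (u : ℤ × ℤ) : Prop :=
  ∀ n a b : ℤ, f (a + n * u.1) (b + n * u.2) = f a b

theorem InvariantUnder.smul {f : ℤ → ℤ → ℂ} {u : ℤ × ℤ} (h : InvariantUnder f u) (m : ℤ) :
    InvariantUnder f (m • u) := fun n a b => by
  simpa [mul_assoc] using h (n * m) a b

theorem det₂_smul_left (m : ℤ) (u w : ℤ × ℤ) : det₂ (m • u) w = m * det₂ u w := by
  simp only [det₂, Prod.smul_fst, Prod.smul_snd, smul_eq_mul]; ring

theorem det₂_smul_right (m : ℤ) (u w : ℤ × ℤ) : det₂ u (m • w) = m * det₂ u w := by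
  simp only [det₂, Prod.smul_fst, Prod.smul_snd, smul_eq_mul]; ring

theorem doublyPeriodic_summand {f : ℤ → ℤ → ℂ} {K : ℕ} (hf : DoublyPeriodic K f)
    {u w : ℤ × ℤ} (h : det₂ u w ∣ K) :
    DoublyPeriodic K fun a b =>
      f a b * (sawtooth ((det₂ (a, b) w : ℝ) / det₂ u w) : ℂ) *
        (sawtooth ((det₂ u (a, b) : ℝ) / det₂ u w) : ℂ) := by
  intro a a' b b' ha hb
  have h1 := det₂_modEq ha hb w
  have h2 := (det₂_modEq ha hb u).neg
  rw [← det₂_swap, ← det₂_swap] at h2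
  simp only [hf ha hb, sawtooth_div_congr (h1.of_dvd h), sawtooth_div_congr (h2.of_dvd h)]

theorem dedekindSymbol_natSmul_left {f : ℤ → ℤ → ℂ} {K : ℕ} (hf : DoublyPeriodic K f)
    {u w : ℤ × ℤ} (hu : InvariantUnder f u) {m : ℕ} (hm : 0 < m) (h : (m : ℤ) * det₂ u w ∣ K) :
    dedekindSymbol f K ((m : ℤ) • u) w = dedekindSymbol f K u w := by
  rcases eq_or_ne (det₂ u w) 0 with h0 | h0
  · rw [dedekindSymbol_eq_zero h0, dedekindSymbol_eq_zero (by rw [det₂_smul_left, h0, mul_zero])]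
  have hm' : (m : ℝ) ≠ 0 := by positivity
  have hd : (det₂ u w : ℝ) ≠ 0 := by exact_mod_cast h0
  set G : ℤ → ℤ → ℂ := fun a b =>
    f a b * (sawtooth ((det₂ (a, b) w : ℝ) / det₂ ((m : ℤ) • u) w) : ℂ) *
      (sawtooth ((det₂ ((m : ℤ) • u) (a, b) : ℝ) / det₂ ((m : ℤ) • u) w) : ℂ) with hG
  have hper : DoublyPeriodic K G := doublyPeriodic_summand hf (by rwa [det₂_smul_left])
  have key : (m : ℂ) * pmean K G = pmean K fun a b =>
      f a b * (sawtooth ((det₂ (a, b) w : ℝ) / det₂ u w) : ℂ) *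
        (sawtooth ((det₂ u (a, b) : ℝ) / det₂ u w) : ℂ) := by
    have h1 : (m : ℂ) * pmean K G = ∑ i ∈ Finset.range m,
        pmean K fun a b => G (a + (i : ℤ) * u.1) (b + (i : ℤ) * u.2) := by
      simp [pmean_translate hper]
    rw [h1, ← pmean_sum]
    refine pmean_congr fun a b => ?_
    rw [← sum_sawtooth_div hm, Complex.ofReal_sum, Finset.mul_sum, Finset.sum_mul]
    refine Finset.sum_congr rfl fun i _ => ?_
    simp only [hG]
    rw [hu]
    congr 1
    · congr 3
      rw [det₂_smul_left]
      simp only [det₂] at hd ⊢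
      push_cast at hd ⊢
      field_simp
      ring
    · congr 2
      rw [det₂_smul_left, det₂_smul_left]
      have : (det₂ u (a + (i : ℤ) * u.1, b + (i : ℤ) * u.2)) = det₂ u (a, b) := by
        simp only [det₂]; ring
      rw [this]
      push_cast
      field_simp
  have hL : dedekindSymbol f K ((m : ℤ) • u) w = det₂ ((m : ℤ) • u) w * pmean K G := rfl
  rw [hL, dedekindSymbol, ← key, det₂_smul_left]
  push_cast
  ring

theorem dedekindSymbol_smul_left {f : ℤ → ℤ → ℂ} {K : ℕ} (hf : DoublyPeriodic K f)
    {u w : ℤ × ℤ} (hu : InvariantUnder f u) {m : ℤ} (hm : m ≠ 0) (h : m * det₂ u w ∣ K) :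
    dedekindSymbol f K (m • u) w = dedekindSymbol f K u w := by
  have hpos : 0 < m.natAbs := Int.natAbs_pos.2 hm
  rcases Int.natAbs_eq m with hm' | hm'
  · rw [hm']
    exact dedekindSymbol_natSmul_left hf hu hpos (by rwa [← hm'])
  · rw [hm', neg_smul, dedekindSymbol_neg_left]
    refine dedekindSymbol_natSmul_left hf hu hpos ?_
    rw [hm', neg_mul] at h
    exact neg_dvd.1 h

theorem dedekindSymbol_smul_right {f : ℤ → ℤ → ℂ} {K : ℕ} (hf : DoublyPeriodic K f)
    {u w : ℤ × ℤ} (hw : InvariantUnder f w) {m : ℤ} (hm : m ≠ 0) (h : m * det₂ u w ∣ K) :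
    dedekindSymbol f K u (m • w) = dedekindSymbol f K u w := by
  rw [dedekindSymbol_swap f K (m • w) u, dedekindSymbol_smul_left hf hw hm,
    ← dedekindSymbol_swap]
  rwa [det₂_swap, mul_neg, neg_dvd]

theorem dedekindSymbol_three_term {f : ℤ → ℤ → ℂ} {K : ℕ} {u w z : ℤ × ℤ}
    (hu : InvariantUnder f u) (hw : InvariantUnder f w) (hz : u + w + z = 0)
    (h0 : f 0 0 = 0) (hd : det₂ u w ≠ 0) :
    dedekindSymbol f K u w + dedekindSymbol f K w z + dedekindSymbol f K z u =
      det₂ u w / 2 * (pmean K (fun a b => f a b * (bern2 ((det₂ (a, b) w : ℝ) / det₂ u w) : ℂ)) +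
        pmean K (fun a b => f a b * (bern2 ((det₂ (a, b) u : ℝ) / det₂ u w) : ℂ)) +
        pmean K (fun a b => f a b * (bern2 ((det₂ (a, b) z : ℝ) / det₂ u w) : ℂ))) := by
  obtain rfl : z = -u - w := by rw [← sub_eq_zero, ← hz]; abel
  have hd' : (det₂ u w : ℝ) ≠ 0 := by exact_mod_cast hd
  have e1 : det₂ w (-u - w) = det₂ u w := by
    simp only [det₂, Prod.fst_sub, Prod.snd_sub, Prod.fst_neg, Prod.snd_neg]; ring
  have e2 : det₂ (-u - w) u = det₂ u w := by
    simp only [det₂, Prod.fst_sub, Prod.snd_sub, Prod.fst_neg, Prod.snd_neg]; ring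
  unfold dedekindSymbol
  rw [e1, e2, ← mul_add, ← mul_add, ← pmean_add, ← pmean_add, ← pmean_add, ← pmean_add,
    div_mul_eq_mul_div, mul_div_assoc]
  congr 1
  rw [div_eq_inv_mul, ← pmean_const_mul]
  refine pmean_congr fun a b => ?_
  set x : ℝ := (det₂ (a, b) w : ℝ) / det₂ u w with hx
  set y : ℝ := (det₂ (a, b) u : ℝ) / det₂ u w with hy
  have f1 : (det₂ (a, b) (-u - w) : ℝ) / det₂ u w = -(x + y) := by
    rw [hx, hy]
    simp only [det₂, Prod.fst_sub, Prod.snd_sub, Prod.fst_neg, Prod.snd_neg]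
    push_cast; ring
  have f2 : (det₂ u (a, b) : ℝ) / det₂ u w = -y := by
    rw [det₂_swap]; push_cast; rw [hy]; ring
  have f3 : (det₂ w (a, b) : ℝ) / det₂ u w = -x := by
    rw [det₂_swap]; push_cast; rw [hx]; ring
  have f4 : (det₂ (-u - w) (a, b) : ℝ) / det₂ u w = x + y := by
    rw [det₂_swap]; push_cast; rw [neg_div, f1]; ring
  rw [f1, f2, f3, f4, bern2_neg]
  simp only [sawtooth_neg]
  by_cases hxy : Int.fract x ≠ 0 ∨ Int.fract y ≠ 0
  · have := congrArg (Complex.ofReal) (sawtooth_mul_three_term x y hxy)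
    push_cast at this ⊢
    linear_combination (-f a b) * this
  · push Not at hxy
    have hf : f a b = 0 := by
      obtain ⟨m, hm⟩ := Int.fract_eq_zero_iff.1 hxy.1
      obtain ⟨n, hn⟩ := Int.fract_eq_zero_iff.1 hxy.2
      rw [← h0, ← hu m 0 0, ← hw n]
      rw [hx, eq_div_iff hd'] at hm
      rw [hy, eq_div_iff hd'] at hn
      have hm' : m * det₂ u w = det₂ (a, b) w := by exact_mod_cast hm
      have hn' : n * det₂ u w = det₂ (a, b) u := by exact_mod_cast hn
      congr 1
      · apply mul_left_cancel₀ hd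
        simp only [det₂] at hm' hn' ⊢
        linear_combination w.1 * hn' - u.1 * hm'
      · apply mul_left_cancel₀ hd
        simp only [det₂] at hm' hn' ⊢
        linear_combination w.2 * hn' - u.2 * hm'
    simp [hf]

/-- The weight `f` has vanishing constant term in the direction `w`. -/
def VanishesAlong (f : ℤ → ℤ → ℂ) (K : ℕ) (w : ℤ × ℤ) : Prop :=
  ∀ g : ℤ → ℂ, (∀ s t : ℤ, s ≡ t [ZMOD K] → g s = g t) →
    pmean K (fun a b => f a b * g (det₂ (a, b) w)) = 0

theorem VanishesAlong.smul {f : ℤ → ℤ → ℂ} {K : ℕ} {w : ℤ × ℤ} (h : VanishesAlong f K w) (m : ℤ) :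
    VanishesAlong f K (m • w) := fun g hg => by
  simp only [det₂_smul_right]
  exact h (fun s => g (m * s)) fun s t hst => hg _ _ (hst.mul_left m)

theorem VanishesAlong.bern2 {f : ℤ → ℤ → ℂ} {K : ℕ} {w : ℤ × ℤ} (h : VanishesAlong f K w) {d : ℤ}
    (hd : d ∣ K) :
    pmean K (fun a b => f a b * (bern2 ((det₂ (a, b) w : ℝ) / d) : ℂ)) = 0 :=
  h (fun s => (NewformDedekind.bern2 ((s : ℝ) / d) : ℂ)) fun s t hst => by
    simp only [bern2_div_congr (hst.of_dvd hd)]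

theorem dedekindSymbol_cocycle_of_ne {f : ℤ → ℤ → ℂ} {K : ℕ} (hf : DoublyPeriodic K f)
    (h0 : f 0 0 = 0) {u w z : ℤ × ℤ}
    (hu : InvariantUnder f u) (hw : InvariantUnder f w) (hz : InvariantUnder f z)
    (vu : VanishesAlong f K u) (vw : VanishesAlong f K w) (vz : VanishesAlong f K z)
    (hne : det₂ u w * det₂ w z * det₂ z u ≠ 0) (hK : det₂ u w * det₂ w z * det₂ z u ∣ K) :
    dedekindSymbol f K u w + dedekindSymbol f K w z + dedekindSymbol f K z u = 0 := by
  have n1 : det₂ u w ≠ 0 := fun h => hne (by rw [h]; ring)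
  have n2 : det₂ w z ≠ 0 := fun h => hne (by rw [h]; ring)
  have n3 : det₂ z u ≠ 0 := fun h => hne (by rw [h]; ring)
  have key : ∀ {u w : ℤ × ℤ} {m n : ℤ}, InvariantUnder f u → InvariantUnder f w → m ≠ 0 → n ≠ 0 →
      n * (m * det₂ u w) ∣ K → dedekindSymbol f K (m • u) (n • w) = dedekindSymbol f K u w := by
    intro u w m n hu hw hm hn h
    rw [dedekindSymbol_smul_right hf hw hn (by rwa [det₂_smul_left]),
      dedekindSymbol_smul_left hf hu hm (dvd_of_mul_left_dvd h)]
  have hs : det₂ w z • u + det₂ z u • w + det₂ u w • z = 0 := by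
    ext <;> simp [det₂] <;> ring
  have := dedekindSymbol_three_term (K := K) (hu.smul (det₂ w z)) (hw.smul (det₂ z u)) hs h0 (by
    rw [det₂_smul_left, det₂_smul_right]; exact mul_ne_zero n2 (mul_ne_zero n3 n1))
  have hd : det₂ (det₂ w z • u) (det₂ z u • w) ∣ K := by
    rw [det₂_smul_left, det₂_smul_right]; convert hK using 1; ring
  rw [(vu.smul _).bern2 hd, (vw.smul _).bern2 hd, (vz.smul _).bern2 hd,
    key hu hw n2 n3 (by convert hK using 1; ring), key hw hz n3 n1 (by convert hK using 1; ring),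
    key hz hu n1 n2 (by convert hK using 1; ring)] at this
  rw [this]; ring

theorem dedekindSymbol_cocycle {f : ℤ → ℤ → ℂ} {K : ℕ} (hf : DoublyPeriodic K f)
    (h0 : f 0 0 = 0) {u w z : ℤ × ℤ}
    (hu : InvariantUnder f u) (hw : InvariantUnder f w) (hz : InvariantUnder f z)
    (vu : VanishesAlong f K u) (vw : VanishesAlong f K w) (vz : VanishesAlong f K z)
    (huw : det₂ u w = 0 → w = u ∨ w = -u) (hwz : det₂ w z = 0 → z = w ∨ z = -w)
    (hzu : det₂ z u = 0 → u = z ∨ u = -z)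
    (hK : det₂ u w * det₂ w z * det₂ z u ≠ 0 → det₂ u w * det₂ w z * det₂ z u ∣ K) :
    dedekindSymbol f K u w + dedekindSymbol f K w z = dedekindSymbol f K u z := by
  by_cases h1 : det₂ u w = 0
  · rw [dedekindSymbol_eq_zero h1]
    rcases huw h1 with rfl | rfl <;> simp [dedekindSymbol_neg_left]
  by_cases h2 : det₂ w z = 0
  · rw [dedekindSymbol_eq_zero h2]
    rcases hwz h2 with rfl | rfl <;> simp [dedekindSymbol_neg_right]
  by_cases h3 : det₂ z u = 0
  · rw [dedekindSymbol_swap f K z u, dedekindSymbol_eq_zero h3]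
    rcases hzu h3 with rfl | rfl
    · rw [dedekindSymbol_swap f K u w]; simp
    · rw [dedekindSymbol_neg_left, dedekindSymbol_swap f K z w]; simp
  have hne := mul_ne_zero (mul_ne_zero h1 h2) h3
  have := dedekindSymbol_cocycle_of_ne hf h0 hu hw hz vu vw vz hne (hK hne)
  rw [dedekindSymbol_swap f K u z] at this
  linear_combination this

/-- The weight `(a, b) ↦ χ̄₁(a) χ̄₂(b)`. -/
noncomputable def weight {q₁ q₂ : ℕ} (χ₁ : DirichletCharacter ℂ q₁)
    (χ₂ : DirichletCharacter ℂ q₂) (a b : ℤ) : ℂ :=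
  (starRingEnd ℂ) (χ₂ (b : ZMod q₂)) * (starRingEnd ℂ) (χ₁ (a : ZMod q₁))

section

variable {q₁ q₂ : ℕ} (χ₁ : DirichletCharacter ℂ q₁) (χ₂ : DirichletCharacter ℂ q₂)

theorem weight_congr {a a' b b' : ℤ} (ha : a ≡ a' [ZMOD q₁]) (hb : b ≡ b' [ZMOD q₂]) :
    weight χ₁ χ₂ a b = weight χ₁ χ₂ a' b' := by
  rw [weight, weight, (ZMod.intCast_eq_intCast_iff _ _ _).2 ha,
    (ZMod.intCast_eq_intCast_iff _ _ _).2 hb]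

theorem weight_mul (a a' b b' : ℤ) :
    weight χ₁ χ₂ (a * a') (b * b') = weight χ₁ χ₂ a b * weight χ₁ χ₂ a' b' := by
  simp only [weight, Int.cast_mul, map_mul]; ring

theorem weight_one : weight χ₁ χ₂ 1 1 = 1 := by simp [weight]

theorem doublyPeriodic_weight {K : ℕ} (h₁ : q₁ ∣ K) (h₂ : q₂ ∣ K) :
    DoublyPeriodic K (weight χ₁ χ₂) := fun _ _ _ _ ha hb =>
  weight_congr χ₁ χ₂ (ha.of_dvd (by exact_mod_cast h₁)) (hb.of_dvd (by exact_mod_cast h₂))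

theorem invariantUnder_weight {u : ℤ × ℤ} (h₁ : (q₁ : ℤ) ∣ u.1) (h₂ : (q₂ : ℤ) ∣ u.2) :
    InvariantUnder (weight χ₁ χ₂) u := fun n a b => by
  apply weight_congr
  · exact Int.modEq_iff_dvd.2 (by simpa using h₁.mul_left n)
  · exact Int.modEq_iff_dvd.2 (by simpa using h₂.mul_left n)

theorem newformDedekindSum_eq (h : ℤ) (k : ℕ) :
    newformDedekindSum χ₁ χ₂ h k =
      ∑ b ∈ Finset.range k, ∑ a ∈ Finset.range q₁, weight χ₁ χ₂ a b *
        (sawtooth ((b : ℝ) / k) : ℂ) * (sawtooth ((a : ℝ) / q₁ + h * b / k) : ℂ) := by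
  simp [newformDedekindSum, weight]

theorem pmean_eq_of_periods {p r K : ℕ} (hK : 0 < K) (hp : p ∣ K) (hr : r ∣ K)
    {g : ℤ → ℤ → ℂ} (hg : ∀ a a' b b' : ℤ, a ≡ a' [ZMOD p] → b ≡ b' [ZMOD r] → g a b = g a' b') :
    (p * r : ℂ) * pmean K g = ∑ b ∈ Finset.range r, ∑ a ∈ Finset.range p, g a b := by
  obtain ⟨m, rfl⟩ := hp
  obtain ⟨n, hn⟩ := hr
  have h1 : ∀ a : ℤ, ∑ b ∈ Finset.range (p * m), g a b = n * ∑ b ∈ Finset.range r, g a b := by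
    intro a
    rw [hn, sum_range_mul_of_periodic n fun b b' hb => hg a a b b' rfl hb]
  have h2 : ∑ a ∈ Finset.range (p * m), ∑ b ∈ Finset.range (p * m), g a b =
      n * (m * ∑ a ∈ Finset.range p, ∑ b ∈ Finset.range r, g a b) := by
    rw [Finset.sum_congr rfl fun (a : ℕ) _ => h1 a, ← Finset.mul_sum]
    rw [sum_range_mul_of_periodic (g := fun a => ∑ b ∈ Finset.range r, g a b) m
      fun a a' ha => Finset.sum_congr rfl fun b _ => hg a a' b b ha rfl]
  rw [pmean, h2, Finset.sum_comm (s := Finset.range r)]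
  have hK' : ((p * m : ℕ) : ℂ) ≠ 0 := by exact_mod_cast hK.ne'
  have hn' : ((p * m : ℕ) : ℂ) = r * n := by exact_mod_cast congrArg (Nat.cast : ℕ → ℂ) hn
  rw [mul_div_assoc', div_eq_iff (pow_ne_zero 2 hK'), sq]
  nth_rewrite 1 [hn']
  push_cast
  ring

theorem periodic_newform_summand {k : ℕ} (hq : q₂ ∣ k) (h : ℤ)
    {a a' b b' : ℤ} (ha : a ≡ a' [ZMOD q₁]) (hb : b ≡ b' [ZMOD k]) :
    weight χ₁ χ₂ a b * (sawtooth ((b : ℝ) / k) : ℂ) *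
        (sawtooth ((a : ℝ) / q₁ + h * b / k) : ℂ) =
      weight χ₁ χ₂ a' b' * (sawtooth ((b' : ℝ) / k) : ℂ) *
        (sawtooth ((a' : ℝ) / q₁ + h * b' / k) : ℂ) := by
  have h1 := sawtooth_div_congr hb
  push_cast at h1
  obtain ⟨s, hs⟩ := div_sub_div_int ha
  obtain ⟨t, ht⟩ := div_sub_div_int hb
  push_cast at hs ht
  rw [weight_congr χ₁ χ₂ ha (hb.of_dvd (by exact_mod_cast hq)), h1,
    sawtooth_eq_of_sub (x := (a : ℝ) / q₁ + h * b / k) (y := (a' : ℝ) / q₁ + h * b' / k) (s + h * t)]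
  push_cast
  rw [← hs, ← ht]
  ring

theorem newformDedekindSum_eq_dedekindSymbol {k K : ℕ} (hq₁ : 0 < q₁) (hk : 0 < k) (hK : 0 < K)
    (hq : q₂ ∣ k) (h₁ : q₁ ∣ K) (h₂ : k ∣ K) (h : ℤ) :
    newformDedekindSum χ₁ χ₂ h k =
      dedekindSymbol (weight χ₁ χ₂) K (-q₁, 0) (-q₁ * h, k) := by
  have hq' : (q₁ : ℝ) ≠ 0 := by exact_mod_cast hq₁.ne'
  have hk' : (k : ℝ) ≠ 0 := by exact_mod_cast hk.ne'
  rw [newformDedekindSum_eq]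
  have key := pmean_eq_of_periods hK h₁ h₂ fun a a' b b' ha hb =>
    periodic_newform_summand χ₁ χ₂ hq h ha hb
  simp only [Int.cast_natCast] at key
  rw [← key, dedekindSymbol]
  have hd : det₂ (-q₁, 0) (-q₁ * h, k) = -(q₁ * k) := by simp [det₂]
  rw [hd]
  push_cast
  rw [neg_mul, ← mul_neg]
  congr 1
  rw [← neg_one_mul, ← pmean_const_mul]
  refine pmean_congr fun a b => ?_
  have e1 : (det₂ (a, b) (-q₁ * h, k) : ℝ) / -(q₁ * k) = -((a : ℝ) / q₁ + h * b / k) := by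
    simp only [det₂]; push_cast; field_simp; ring
  have e2 : (det₂ (-q₁, 0) (a, b) : ℝ) / -(q₁ * k) = (b : ℝ) / k := by
    simp only [det₂]; push_cast; field_simp; ring
  rw [e1, e2, sawtooth_neg]
  push_cast
  ring

/-- The direction of the cusp `γ ∞`, in rescaled coordinates. -/
def cuspDir (q₁ : ℕ) (γ : Matrix.SpecialLinearGroup (Fin 2) ℤ) : ℤ × ℤ :=
  (-q₁ * γ.1 0 0, γ.1 1 0)

theorem det₂_base (γ : Matrix.SpecialLinearGroup (Fin 2) ℤ) :
    det₂ (-q₁, 0) (cuspDir q₁ γ) = -(q₁ * γ.1 1 0) := by simp [det₂, cuspDir]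

theorem SGamma_eq_dedekindSymbol {K : ℕ} (hq₁ : 0 < q₁) (hK : 0 < K)
    (h₁ : q₁ ∣ K) {γ : Matrix.SpecialLinearGroup (Fin 2) ℤ} (hq : (q₂ : ℤ) ∣ γ.1 1 0)
    (h₂ : γ.1 1 0 ≠ 0 → γ.1 1 0 ∣ K) :
    SGamma χ₁ χ₂ γ = dedekindSymbol (weight χ₁ χ₂) K (-q₁, 0) (cuspDir q₁ γ) := by
  have hdir : ∀ k : ℕ, 0 < k → ∀ ε : ℤ, γ.1 1 0 = ε * k → IsUnit ε →
      newformDedekindSum χ₁ χ₂ (ε * γ.1 0 0) k =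
        dedekindSymbol (weight χ₁ χ₂) K (-q₁, 0) (-q₁ * (ε * γ.1 0 0), k) := by
    intro k hk ε hε hu
    have hz : (k : ℤ) ≠ 0 := by exact_mod_cast hk.ne'
    refine newformDedekindSum_eq_dedekindSymbol χ₁ χ₂ hq₁ hk hK ?_ h₁ ?_ _
    · rw [hε, hu.dvd_mul_left] at hq
      exact_mod_cast hq
    · have := h₂ (by rw [hε]; exact mul_ne_zero hu.ne_zero hz)
      rw [hε, hu.mul_left_dvd] at this
      exact_mod_cast this
  unfold SGamma
  split_ifs with hpos hneg
  · obtain ⟨k, hk⟩ := Int.eq_ofNat_of_zero_le hpos.le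
    have := hdir k (by omega) 1 (by simpa using hk) isUnit_one
    simp only [one_mul] at this
    rw [cuspDir, hk]
    exact this
  · obtain ⟨k, hk⟩ := Int.eq_ofNat_of_zero_le (a := -γ.1 1 0) (by omega)
    have := hdir k (by omega) (-1) (by omega) isUnit_one.neg
    rw [neg_one_mul] at this
    rw [hk]
    refine this.trans ?_
    rw [← dedekindSymbol_neg_right]
    congr 1
    ext
    · simp [cuspDir]
    · simp [cuspDir, ← hk]
  · rw [dedekindSymbol_eq_zero]
    rw [det₂_base, show γ.1 1 0 = 0 by omega]
    simp

end

/-- The action of the matrix `(p q; r s)` on integral vectors. -/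
def act (p q r s : ℤ) (v : ℤ × ℤ) : ℤ × ℤ := (p * v.1 + q * v.2, r * v.1 + s * v.2)

theorem det₂_act {p q r s : ℤ} (h : p * s - q * r = 1) (u w : ℤ × ℤ) :
    det₂ (act p q r s u) (act p q r s w) = det₂ u w := by
  simp only [det₂, act]; linear_combination (u.1 * w.2 - u.2 * w.1) * h

theorem dedekindSymbol_act {f : ℤ → ℤ → ℂ} {K : ℕ} (hf : DoublyPeriodic K f) {p q r s : ℤ} {c : ℂ}
    (h : p * s - q * r = 1) (hc : ∀ a b, f (p * a + q * b) (r * a + s * b) = c * f a b)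
    {u w : ℤ × ℤ} (hK : det₂ u w ≠ 0 → det₂ u w ∣ K) :
    dedekindSymbol f K (act p q r s u) (act p q r s w) = c * dedekindSymbol f K u w := by
  by_cases h0 : det₂ u w = 0
  · rw [dedekindSymbol_eq_zero h0, dedekindSymbol_eq_zero (by rwa [det₂_act h]), mul_zero]
  have hper := doublyPeriodic_summand hf (u := act p q r s u) (w := act p q r s w)
    (by rw [det₂_act h]; exact hK h0)
  rw [dedekindSymbol, dedekindSymbol, ← pmean_linear hper h, det₂_act h, mul_left_comm]
  congr 1
  rw [← pmean_const_mul]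
  refine pmean_congr fun a b => ?_
  have e1 : det₂ (p * a + q * b, r * a + s * b) (act p q r s w) = det₂ (a, b) w :=
    det₂_act h (a, b) w
  have e2 : det₂ (act p q r s u) (p * a + q * b, r * a + s * b) = det₂ u (a, b) :=
    det₂_act h u (a, b)
  rw [hc, e1, e2]
  ring

theorem VanishesAlong.act {f : ℤ → ℤ → ℂ} {K : ℕ} (hf : DoublyPeriodic K f) {p q r s : ℤ} {c : ℂ}
    (h : p * s - q * r = 1) (hc : ∀ a b, f (p * a + q * b) (r * a + s * b) = c * f a b)
    {w : ℤ × ℤ} (hw : VanishesAlong f K w) : VanishesAlong f K (act p q r s w) := by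
  intro g hg
  have hper : DoublyPeriodic K fun a b => f a b * g (det₂ (a, b) (NewformDedekind.act p q r s w)) :=
    fun a a' b b' ha hb => by
      simp only [hf ha hb, hg _ _ (det₂_modEq ha hb _)]
  rw [← pmean_linear hper h]
  have e1 : ∀ a b, det₂ (p * a + q * b, r * a + s * b) (NewformDedekind.act p q r s w) =
      det₂ (a, b) w := fun a b => det₂_act h (a, b) w
  simp only [e1, hc, mul_assoc]
  rw [pmean_const_mul, hw g hg, mul_zero]

theorem eq_or_eq_neg_of_det_eq_zero {a b c d a' b' c' d' : ℤ} (h : a * d - b * c = 1)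
    (h' : a' * d' - b' * c' = 1) (h0 : a * c' = a' * c) :
    (a' = a ∧ c' = c) ∨ (a' = -a ∧ c' = -c) := by
  have ha : a' = a * (d * a' - b * c') := by linear_combination (-a') * h + b * h0
  have hc : c' = c * (d * a' - b * c') := by linear_combination (-c') * h + d * h0
  set e := d * a' - b * c'
  have he : IsUnit e := IsUnit.of_mul_eq_one (a * d' - b' * c) (by
    rw [← h', ha, hc]; ring)
  rcases Int.isUnit_iff.1 he with he | he <;> rw [he] at ha hc
  · left; constructor <;> linarith
  · right; constructor <;> linarith

theorem det_entries (γ : Matrix.SpecialLinearGroup (Fin 2) ℤ) :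
    γ.1 0 0 * γ.1 1 1 - γ.1 0 1 * γ.1 1 0 = 1 := by
  rw [← Matrix.det_fin_two]; exact γ.2

theorem cuspDir_eq_or_eq_neg {q₁ : ℕ} (hq₁ : 0 < q₁) {γ γ' : Matrix.SpecialLinearGroup (Fin 2) ℤ}
    (h : det₂ (cuspDir q₁ γ) (cuspDir q₁ γ') = 0) :
    cuspDir q₁ γ' = cuspDir q₁ γ ∨ cuspDir q₁ γ' = -cuspDir q₁ γ := by
  have hq : (q₁ : ℤ) ≠ 0 := by exact_mod_cast hq₁.ne'
  rcases eq_or_eq_neg_of_det_eq_zero (det_entries γ) (det_entries γ') (by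
    apply mul_left_cancel₀ hq
    simp only [det₂, cuspDir] at h
    linear_combination -h) with ⟨h1, h2⟩ | ⟨h1, h2⟩
  · left; simp [cuspDir, h1, h2]
  · right; ext <;> simp [cuspDir, h1, h2]

theorem exists_common_multiple {N : ℕ} (hN : 0 < N) (s : Finset ℤ) :
    ∃ K : ℕ, 0 < K ∧ N ∣ K ∧ ∀ x ∈ s, x ≠ 0 → x ∣ K := by
  refine ⟨N * ∏ x ∈ s.erase 0, x.natAbs, ?_, dvd_mul_right _ _, fun x hx h0 => ?_⟩
  · refine Nat.mul_pos hN (Finset.prod_pos fun x hx => ?_)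
    exact Int.natAbs_pos.2 (Finset.ne_of_mem_erase hx)
  · rw [← Int.natAbs_dvd_natAbs, Int.natAbs_natCast]
    exact (Finset.dvd_prod_of_mem Int.natAbs (Finset.mem_erase.2 ⟨h0, hx⟩)).mul_left N

section

variable {q₁ q₂ : ℕ} (χ₁ : DirichletCharacter ℂ q₁) (χ₂ : DirichletCharacter ℂ q₂)

theorem sum_conj_eq_zero {q K : ℕ} {χ : DirichletCharacter ℂ q} (hq : 0 < q) (hχ : χ ≠ 1)
    (hK : q ∣ K) :
    ∑ a ∈ Finset.range K, (starRingEnd ℂ) (χ ((a : ℤ) : ZMod q)) = 0 := by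
  have : NeZero q := ⟨hq.ne'⟩
  obtain ⟨m, rfl⟩ := hK
  rw [sum_range_mul_of_periodic (g := fun a => (starRingEnd ℂ) (χ (a : ZMod q))) m
    fun a b hab => by rw [(ZMod.intCast_eq_intCast_iff _ _ _).2 hab],
    sum_range_eq_sum_zmod fun a => (starRingEnd ℂ) (χ (a : ZMod q))]
  simp only [Int.cast_natCast, ZMod.natCast_zmod_val]
  rw [← map_sum, MulChar.sum_eq_zero_of_ne_one hχ, map_zero, mul_zero]

theorem vanishesAlong_base (hq₁ : 0 < q₁) (hχ₁ : χ₁ ≠ 1) {K : ℕ} (hK : q₁ ∣ K) :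
    VanishesAlong (weight χ₁ χ₂) K (-q₁, 0) := by
  intro g _
  rw [pmean, Finset.sum_comm]
  simp only [det₂, weight]
  have : ∀ b ∈ Finset.range K, ∑ a ∈ Finset.range K,
      (starRingEnd ℂ) (χ₂ ((b : ℤ) : ZMod q₂)) * (starRingEnd ℂ) (χ₁ ((a : ℤ) : ZMod q₁)) *
        g ((a : ℤ) * 0 - b * (-q₁)) = 0 := by
    intro b _
    have h : ∀ a : ℤ, a * 0 - b * (-(q₁ : ℤ)) = b * q₁ := fun a => by ring
    simp only [h]
    rw [← Finset.sum_mul, ← Finset.mul_sum, sum_conj_eq_zero hq₁ hχ₁ hK]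
    ring
  rw [Finset.sum_eq_zero this, zero_div]

theorem weight_act {γ : Matrix.SpecialLinearGroup (Fin 2) ℤ} {e : ℤ} (he : (q₂ : ℤ) ∣ e) (a b : ℤ) :
    weight χ₁ χ₂ (γ.1 0 0 * a + -(q₁ * γ.1 0 1) * b) (-e * a + γ.1 1 1 * b) =
      weight χ₁ χ₂ (γ.1 0 0) (γ.1 1 1) * weight χ₁ χ₂ a b := by
  rw [← weight_mul]
  apply weight_congr
  · exact Int.modEq_iff_dvd.2 ⟨γ.1 0 1 * b, by ring⟩
  · obtain ⟨e', rfl⟩ := he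
    exact Int.modEq_iff_dvd.2 ⟨e' * a, by ring⟩

/-- Newform Dedekind sums satisfy the crossed homomorphism relation on `Γ₀(q₁q₂)`. -/
theorem SGamma_mul (hq₁ : 0 < q₁) (hq₂ : 1 < q₂) (hχ₁ : χ₁ ≠ 1)
    {γ γ' : Matrix.SpecialLinearGroup (Fin 2) ℤ}
    (hγ : γ ∈ CongruenceSubgroup.Gamma0 (q₁ * q₂)) (hγ' : γ' ∈ CongruenceSubgroup.Gamma0 (q₁ * q₂)) :
    SGamma χ₁ χ₂ (γ * γ') =
      SGamma χ₁ χ₂ γ + weight χ₁ χ₂ (γ.1 0 0) (γ.1 1 1) * SGamma χ₁ χ₂ γ' := by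
  have hγγ' := mul_mem hγ hγ'
  have hmem : ∀ {δ : Matrix.SpecialLinearGroup (Fin 2) ℤ},
      δ ∈ CongruenceSubgroup.Gamma0 (q₁ * q₂) → ∃ e : ℤ, δ.1 1 0 = q₁ * (q₂ * e) := by
    intro δ hδ
    obtain ⟨e, he⟩ := (ZMod.intCast_zmod_eq_zero_iff_dvd _ _).1 (CongruenceSubgroup.Gamma0_mem.1 hδ)
    exact ⟨e, by rw [he]; push_cast; ring⟩
  have hq₂dvd : ∀ {δ : Matrix.SpecialLinearGroup (Fin 2) ℤ},
      δ ∈ CongruenceSubgroup.Gamma0 (q₁ * q₂) → (q₂ : ℤ) ∣ δ.1 1 0 := by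
    intro δ hδ
    obtain ⟨e, he⟩ := hmem hδ
    exact ⟨q₁ * e, by rw [he]; ring⟩
  set u : ℤ × ℤ := (-q₁, 0) with hu
  set w := cuspDir q₁ γ with hw
  set z := cuspDir q₁ (γ * γ') with hz
  have hu1 : u = cuspDir q₁ 1 := by simp [cuspDir, hu]
  obtain ⟨K, hK, hN, hdvd⟩ := exists_common_multiple (Nat.mul_pos hq₁ (by omega : 0 < q₂))
    {-(q₁ * γ.1 1 0), -(q₁ * γ'.1 1 0), -(q₁ * (γ * γ').1 1 0), det₂ u w * det₂ w z * det₂ z u}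
  have hq₁K : q₁ ∣ K := (dvd_mul_right _ _).trans hN
  have hq₂K : q₂ ∣ K := (dvd_mul_left _ _).trans hN
  have hq : (q₁ : ℤ) ≠ 0 := by exact_mod_cast hq₁.ne'
  have hc : ∀ c : ℤ, (-(q₁ * c) ≠ 0 → -(q₁ * c) ∣ (K : ℤ)) → c ≠ 0 → c ∣ (K : ℤ) := by
    intro c h h0
    exact dvd_of_mul_left_dvd (neg_dvd.1 (h (neg_ne_zero.2 (mul_ne_zero hq h0))))
  have hd1 := hdvd (-(q₁ * γ.1 1 0)) (by simp)
  have hd2 := hdvd (-(q₁ * γ'.1 1 0)) (by simp)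
  have hd3 := hdvd (-(q₁ * (γ * γ').1 1 0)) (by simp)
  have hd4 := hdvd (det₂ u w * det₂ w z * det₂ z u) (by simp)
  have hper := doublyPeriodic_weight χ₁ χ₂ hq₁K hq₂K
  rw [SGamma_eq_dedekindSymbol χ₁ χ₂ hq₁ hK hq₁K (hq₂dvd hγ) (hc _ hd1),
    SGamma_eq_dedekindSymbol χ₁ χ₂ hq₁ hK hq₁K (hq₂dvd hγ') (hc _ hd2),
    SGamma_eq_dedekindSymbol χ₁ χ₂ hq₁ hK hq₁K (hq₂dvd hγγ') (hc _ hd3)]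
  have hact : ∀ {δ : Matrix.SpecialLinearGroup (Fin 2) ℤ} {e : ℤ}, δ.1 1 0 = q₁ * (q₂ * e) →
      ∀ δ', cuspDir q₁ (δ * δ') =
        act (δ.1 0 0) (-(q₁ * δ.1 0 1)) (-(q₂ * e)) (δ.1 1 1) (cuspDir q₁ δ') := by
    intro δ e he δ'
    have h00 : (δ * δ').1 0 0 = δ.1 0 0 * δ'.1 0 0 + δ.1 0 1 * δ'.1 1 0 := by
      simp [Matrix.mul_apply, Fin.sum_univ_two]
    have h10 : (δ * δ').1 1 0 = δ.1 1 0 * δ'.1 0 0 + δ.1 1 1 * δ'.1 1 0 := by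
      simp [Matrix.mul_apply, Fin.sum_univ_two]
    ext
    · simp only [cuspDir, act, h00]; ring
    · simp only [cuspDir, act, h10, he]; ring
  have hdet : ∀ {δ : Matrix.SpecialLinearGroup (Fin 2) ℤ} {e : ℤ}, δ.1 1 0 = q₁ * (q₂ * e) →
      δ.1 0 0 * δ.1 1 1 - -(q₁ * δ.1 0 1) * (-(q₂ * e)) = 1 := by
    intro δ e he
    linear_combination det_entries δ + δ.1 0 1 * he
  have hvan : ∀ {δ : Matrix.SpecialLinearGroup (Fin 2) ℤ},
      δ ∈ CongruenceSubgroup.Gamma0 (q₁ * q₂) → VanishesAlong (weight χ₁ χ₂) K (cuspDir q₁ δ) := by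
    intro δ hδ
    obtain ⟨e, he⟩ := hmem hδ
    rw [← mul_one δ, hact he, ← hu1]
    exact VanishesAlong.act hper (hdet he) (weight_act χ₁ χ₂ (dvd_mul_right _ _))
      (vanishesAlong_base χ₁ χ₂ hq₁ hχ₁ hq₁K)
  have hinv : ∀ {δ : Matrix.SpecialLinearGroup (Fin 2) ℤ},
      δ ∈ CongruenceSubgroup.Gamma0 (q₁ * q₂) → InvariantUnder (weight χ₁ χ₂) (cuspDir q₁ δ) :=
    fun {δ} hδ => invariantUnder_weight χ₁ χ₂ ⟨-δ.1 0 0, by simp [cuspDir]⟩ (hq₂dvd hδ)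
  have h00 : weight χ₁ χ₂ 0 0 = 0 := by
    have : Fact (1 < q₂) := ⟨hq₂⟩
    simp [weight, MulChar.map_zero]
  have hcoc := dedekindSymbol_cocycle hper h00 (hu1 ▸ hinv (one_mem _)) (hinv hγ) (hinv hγγ')
    (hu1 ▸ hvan (one_mem _)) (hvan hγ) (hvan hγγ')
    (fun h => by rw [hu1] at h ⊢; exact cuspDir_eq_or_eq_neg hq₁ h)
    (fun h => cuspDir_eq_or_eq_neg hq₁ h)
    (fun h => by rw [hu1] at h ⊢; exact cuspDir_eq_or_eq_neg hq₁ h) hd4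
  rw [← hcoc]
  congr 1
  obtain ⟨e, he⟩ := hmem hγ
  have hw' : cuspDir q₁ γ = act (γ.1 0 0) (-(q₁ * γ.1 0 1)) (-(q₂ * e)) (γ.1 1 1) u := by
    rw [hu1, ← hact he, mul_one]
  rw [hact he, hw']
  exact dedekindSymbol_act hper (hdet he) (weight_act χ₁ χ₂ (dvd_mul_right _ _))
    (by rw [det₂_base]; exact hd2)

end

theorem hasSum_cos_bern2 (x : ℝ) :
    HasSum (fun m : ℕ => 1 / (m : ℝ) ^ 2 * Real.cos (2 * Real.pi * m * x))
      (Real.pi ^ 2 * bern2 x) := by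
  have h := hasSum_one_div_nat_pow_mul_cos one_ne_zero
    (x := Int.fract x) ⟨Int.fract_nonneg x, (Int.fract_lt_one x).le⟩
  have hb : (Polynomial.map (algebraMap ℚ ℝ) (Polynomial.bernoulli (2 * 1))).eval (Int.fract x) =
      bern2 x := by
    simp only [Polynomial.bernoulli, mul_one, Finset.sum_range_succ, Finset.sum_range_zero,
      bernoulli_zero, bernoulli_one, bernoulli_two, bern2, Polynomial.map_add,
      Polynomial.map_monomial, Polynomial.eval_add, Polynomial.eval_monomial]
    norm_num
    ring
  rw [hb, mul_one] at h
  convert h using 1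
  · ext m
    have : 2 * Real.pi * m * x = 2 * Real.pi * m * Int.fract x + (m * ⌊x⌋ : ℤ) * (2 * Real.pi) := by
      nth_rewrite 1 [← Int.floor_add_fract x]
      push_cast
      ring
    rw [this, Real.cos_add_int_mul_two_pi]
  · rw [Nat.factorial_two]
    push_cast
    ring

theorem two_mul_cos_eq {q₁ q₂ : ℕ} [NeZero q₁] [NeZero q₂] (m : ℕ) (x : ZMod q₁) (y : ZMod q₂) :
    2 * (Real.cos (2 * Real.pi * m * ((x.val : ℝ) / q₁ + (y.val : ℝ) / q₂)) : ℂ) =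
      ZMod.stdAddChar ((m : ZMod q₁) * x) * ZMod.stdAddChar ((m : ZMod q₂) * y) +
        ZMod.stdAddChar (-(m : ZMod q₁) * x) * ZMod.stdAddChar (-(m : ZMod q₂) * y) := by
  have key : ∀ {q : ℕ} [NeZero q] (n : ℤ) (z : ZMod q),
      ZMod.stdAddChar ((n : ZMod q) * z) =
        Complex.exp (2 * Real.pi * Complex.I * n * (z.val : ℂ) / q) := by
    intro q _ n z
    have : (n : ZMod q) * z = ((n * z.val : ℤ) : ZMod q) := by simp
    rw [this, ZMod.stdAddChar_coe]
    push_cast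
    ring_nf
  have h₁ := key (q := q₁) (-m : ℤ) x
  have h₂ := key (q := q₂) (-m : ℤ) y
  have h₃ := key (q := q₁) (m : ℤ) x
  have h₄ := key (q := q₂) (m : ℤ) y
  push_cast at h₁ h₂ h₃ h₄
  rw [h₁, h₂, h₃, h₄, ← Complex.exp_add, ← Complex.exp_add, Complex.ofReal_cos, Complex.cos]
  push_cast
  rw [mul_div_cancel₀ _ two_ne_zero]
  congr 2 <;> ring

theorem gaussSum_ne_zero_of_isPrimitive {q : ℕ} [NeZero q] {χ : DirichletCharacter ℂ q}
    (hχ : χ.IsPrimitive) : gaussSum χ ZMod.stdAddChar ≠ 0 := by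
  intro h
  have h1 : ZMod.dft (χ : ZMod q → ℂ) = 0 := by
    ext k
    rw [hχ.fourierTransform_eq_inv_mul_gaussSum, h, mul_zero]; rfl
  have h2 : (χ : ZMod q → ℂ) = 0 := by simpa using h1
  simpa using congrFun h2 1

theorem norm_tsum_one_div_sq_sub_one_lt {f : ℕ → ℂ} (h0 : f 0 = 0) (h1 : f 1 = 1)
    (hf : ∀ m, ‖f m‖ ≤ 1) : ∑' m : ℕ, 1 / (m : ℂ) ^ 2 * f m ≠ 0 := by
  have hle : ∀ m : ℕ, ‖1 / (m : ℂ) ^ 2 * f m‖ ≤ 1 / (m : ℝ) ^ 2 := fun m => by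
    rw [norm_mul, norm_div, norm_one, norm_pow, Complex.norm_natCast]
    exact mul_le_of_le_one_right (by positivity) (hf m)
  have hz := hasSum_zeta_two
  have hs : Summable fun m : ℕ => 1 / (m : ℂ) ^ 2 * f m :=
    Summable.of_norm_bounded hz.summable hle
  intro h
  have e1 := hs.sum_add_tsum_nat_add 2
  have e2 := hz.summable.sum_add_tsum_nat_add 2
  rw [hz.tsum_eq] at e2
  simp only [Finset.sum_range_succ, Finset.sum_range_zero, h0, h1, h] at e1 e2
  have hb : ‖∑' m : ℕ, 1 / ((m + 2 : ℕ) : ℂ) ^ 2 * f (m + 2)‖ ≤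
      ∑' m : ℕ, 1 / ((m + 2 : ℕ) : ℝ) ^ 2 :=
    tsum_of_norm_bounded ((summable_nat_add_iff 2).2 hz.summable).hasSum fun m => hle (m + 2)
  have e3 : ∑' m : ℕ, 1 / ((m + 2 : ℕ) : ℂ) ^ 2 * f (m + 2) = -1 := by
    norm_num at e1 ⊢
    linear_combination e1
  rw [e3, norm_neg, norm_one] at hb
  norm_num at e2 hb
  have hpi := Real.pi_lt_d2
  have hpi' := Real.pi_pos
  nlinarith

section

variable {q₁ q₂ : ℕ} {χ₁ : DirichletCharacter ℂ q₁} {χ₂ : DirichletCharacter ℂ q₂}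

theorem sum_bern2_ne_zero [NeZero q₁] [NeZero q₂] (hq₁ : 1 < q₁)
    (hχ₁ : χ₁.IsPrimitive) (hχ₂ : χ₂.IsPrimitive) (hpar : χ₁ (-1) * χ₂ (-1) = 1) :
    ∑ x : ZMod q₁, ∑ y : ZMod q₂, χ₁⁻¹ x * χ₂⁻¹ y *
      (bern2 ((x.val : ℝ) / q₁ + (y.val : ℝ) / q₂) : ℂ) ≠ 0 := by
  have hψ₁ : (χ₁⁻¹).IsPrimitive := by
    rw [DirichletCharacter.IsPrimitive, DirichletCharacter.conductor_inv]; exact hχ₁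
  have hψ₂ : (χ₂⁻¹).IsPrimitive := by
    rw [DirichletCharacter.IsPrimitive, DirichletCharacter.conductor_inv]; exact hχ₂
  set G₁ := gaussSum χ₁⁻¹ ZMod.stdAddChar
  set G₂ := gaussSum χ₂⁻¹ ZMod.stdAddChar
  have gs₁ : ∀ a : ZMod q₁, ∑ x, χ₁⁻¹ x * ZMod.stdAddChar (a * x) = χ₁ a * G₁ := fun a => by
    simpa [gaussSum, G₁] using gaussSum_mulShift_of_isPrimitive ZMod.stdAddChar hψ₁ a
  have gs₂ : ∀ a : ZMod q₂, ∑ x, χ₂⁻¹ x * ZMod.stdAddChar (a * x) = χ₂ a * G₂ := fun a => by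
    simpa [gaussSum, G₂] using gaussSum_mulShift_of_isPrimitive ZMod.stdAddChar hψ₂ a
  have inner : ∀ m : ℕ, ∑ x : ZMod q₁, ∑ y : ZMod q₂, χ₁⁻¹ x * χ₂⁻¹ y *
      (Real.cos (2 * Real.pi * m * ((x.val : ℝ) / q₁ + (y.val : ℝ) / q₂)) : ℂ) =
        χ₁ m * χ₂ m * (G₁ * G₂) := by
    intro m
    have hm₁ : χ₁ (-m) = χ₁ (-1) * χ₁ m := by rw [← map_mul, neg_one_mul]
    have hm₂ : χ₂ (-m) = χ₂ (-1) * χ₂ m := by rw [← map_mul, neg_one_mul]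
    apply mul_left_cancel₀ (two_ne_zero (α := ℂ))
    calc _ = ∑ x : ZMod q₁, ∑ y : ZMod q₂,
          ((χ₁⁻¹ x * ZMod.stdAddChar ((m : ZMod q₁) * x)) *
            (χ₂⁻¹ y * ZMod.stdAddChar ((m : ZMod q₂) * y)) +
          (χ₁⁻¹ x * ZMod.stdAddChar (-(m : ZMod q₁) * x)) *
            (χ₂⁻¹ y * ZMod.stdAddChar (-(m : ZMod q₂) * y))) := by
            simp only [Finset.mul_sum]
            refine Finset.sum_congr rfl fun x _ => Finset.sum_congr rfl fun y _ => ?_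
            linear_combination χ₁⁻¹ x * χ₂⁻¹ y * two_mul_cos_eq m x y
      _ = χ₁ m * G₁ * (χ₂ m * G₂) + χ₁ (-m) * G₁ * (χ₂ (-m) * G₂) := by
            simp only [Finset.sum_add_distrib, ← Finset.sum_mul_sum, gs₁, gs₂]
      _ = _ := by
            rw [hm₁, hm₂]
            linear_combination χ₁ m * G₁ * (χ₂ m * G₂) * hpar
  have hsum : HasSum (fun m : ℕ => 1 / (m : ℂ) ^ 2 * (χ₁ m * χ₂ m) * (G₁ * G₂))
      ((Real.pi : ℂ) ^ 2 * ∑ x : ZMod q₁, ∑ y : ZMod q₂, χ₁⁻¹ x * χ₂⁻¹ y *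
        (bern2 ((x.val : ℝ) / q₁ + (y.val : ℝ) / q₂) : ℂ)) := by
    have h : HasSum (fun m : ℕ => ∑ x : ZMod q₁, ∑ y : ZMod q₂, χ₁⁻¹ x * χ₂⁻¹ y *
        ((1 / (m : ℝ) ^ 2 *
          Real.cos (2 * Real.pi * m * ((x.val : ℝ) / q₁ + (y.val : ℝ) / q₂)) : ℝ) : ℂ))
        (∑ x : ZMod q₁, ∑ y : ZMod q₂, χ₁⁻¹ x * χ₂⁻¹ y *
          ((Real.pi ^ 2 * bern2 ((x.val : ℝ) / q₁ + (y.val : ℝ) / q₂) : ℝ) : ℂ)) :=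
      hasSum_sum fun x _ => hasSum_sum fun y _ =>
        (Complex.hasSum_ofReal.2 (hasSum_cos_bern2 _)).mul_left _
    convert h using 1
    · ext m
      rw [mul_assoc, ← inner, Finset.mul_sum]
      refine Finset.sum_congr rfl fun x _ => ?_
      rw [Finset.mul_sum]
      refine Finset.sum_congr rfl fun y _ => ?_
      push_cast
      ring
    · rw [Finset.mul_sum]
      refine Finset.sum_congr rfl fun x _ => ?_
      rw [Finset.mul_sum]
      refine Finset.sum_congr rfl fun y _ => ?_
      push_cast
      ring
  intro h0
  rw [h0, mul_zero] at hsum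
  have hG : G₁ * G₂ ≠ 0 :=
    mul_ne_zero (gaussSum_ne_zero_of_isPrimitive hψ₁) (gaussSum_ne_zero_of_isPrimitive hψ₂)
  have := hsum.tsum_eq
  rw [tsum_mul_right] at this
  refine norm_tsum_one_div_sq_sub_one_lt (f := fun m => χ₁ m * χ₂ m) ?_ (by simp) ?_
    ((mul_eq_zero.1 this).resolve_right hG)
  · simp [DirichletCharacter.map_zero' χ₁ hq₁.ne']
  · intro m
    rw [norm_mul]
    exact mul_le_one₀ (DirichletCharacter.norm_le_one _ _) (norm_nonneg _)
      (DirichletCharacter.norm_le_one _ _)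

end

theorem conj_eq_inv {q : ℕ} (χ : DirichletCharacter ℂ q) (x : ZMod q) :
    (starRingEnd ℂ) (χ x) = χ⁻¹ x := MulChar.star_apply' χ x

theorem ne_one_of_isPrimitive {q : ℕ} {χ : DirichletCharacter ℂ q} (hq : 1 < q)
    (hχ : χ.IsPrimitive) : χ ≠ 1 := by
  have : NeZero q := ⟨by omega⟩
  rintro rfl
  rw [DirichletCharacter.IsPrimitive, DirichletCharacter.conductor_one] at hχ
  omega

/-- A matrix of `Γ₁(q₁q₂)` fixing the cusp `1/q₂`. -/
def parabolic (q₁ q₂ : ℕ) : Matrix.SpecialLinearGroup (Fin 2) ℤ :=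
  ⟨!![1 - q₁ * q₂, q₁; -(q₁ * q₂ * q₂), 1 + q₁ * q₂], by
    rw [Matrix.det_fin_two_of]; ring⟩

theorem parabolic_mem (q₁ q₂ : ℕ) : parabolic q₁ q₂ ∈ CongruenceSubgroup.Gamma1 (q₁ * q₂) := by
  have h : (q₁ : ZMod (q₁ * q₂)) * (q₂ : ZMod (q₁ * q₂)) = 0 := by
    rw [← Nat.cast_mul, ZMod.natCast_self]
  rw [CongruenceSubgroup.Gamma1_mem]
  simp [parabolic, h]

section

variable {q₁ q₂ : ℕ} (χ₁ : DirichletCharacter ℂ q₁) (χ₂ : DirichletCharacter ℂ q₂)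

theorem SGamma_parabolic (hq₁ : 0 < q₁) (hq₂ : 1 < q₂) (hχ₁ : χ₁ ≠ 1) :
    SGamma χ₁ χ₂ (parabolic q₁ q₂) = -((q₁ * q₂) ^ 2 / 2 * pmean ((q₁ * q₂) ^ 2) fun a b =>
      weight χ₁ χ₂ a b * (bern2 ((a : ℝ) / q₁ + (b : ℝ) / q₂) : ℂ)) := by
  set K := (q₁ * q₂) ^ 2 with hKdef
  have hq₂' : 0 < q₂ := by omega
  have hK : 0 < K := by positivity
  have hN : q₁ * q₂ ∣ K := dvd_pow_self _ two_ne_zero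
  have hq₁K : q₁ ∣ K := (dvd_mul_right _ _).trans hN
  have hq₂K : q₂ ∣ K := (dvd_mul_left _ _).trans hN
  have hper := doublyPeriodic_weight χ₁ χ₂ hq₁K hq₂K
  have hz₁ : (q₁ : ℤ) ≠ 0 := by exact_mod_cast hq₁.ne'
  have hz₂ : (q₂ : ℤ) ≠ 0 := by exact_mod_cast hq₂'.ne'
  have h00 : weight χ₁ χ₂ 0 0 = 0 := by
    have : Fact (1 < q₂) := ⟨hq₂⟩
    simp [weight, MulChar.map_zero]
  set u : ℤ × ℤ := (-q₁, 0) with hu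
  set w : ℤ × ℤ := (-q₁, q₂) with hw
  set z := cuspDir q₁ (parabolic q₁ q₂) with hz
  have hzeq : z = u - (q₁ * q₂ : ℤ) • w := by
    ext
    · simp [hz, hu, hw, cuspDir, parabolic]; ring
    · simp [hz, hu, hw, cuspDir, parabolic]
  have hact : ∀ a b, weight χ₁ χ₂ ((1 - q₁ * q₂) * a + -(q₁ * q₁) * b)
      (q₂ * q₂ * a + (1 + q₁ * q₂) * b) = 1 * weight χ₁ χ₂ a b := fun a b => by
    rw [one_mul]
    apply weight_congr
    · exact Int.modEq_iff_dvd.2 ⟨q₂ * a + q₁ * b, by ring⟩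
    · exact Int.modEq_iff_dvd.2 ⟨-(q₂ * a + q₁ * b), by ring⟩
  have hdet : (1 - q₁ * q₂ : ℤ) * (1 + q₁ * q₂) - -(q₁ * q₁ : ℤ) * (q₂ * q₂) = 1 := by ring
  have hzact : act (1 - q₁ * q₂) (-(q₁ * q₁)) (q₂ * q₂) (1 + q₁ * q₂) u = z := by
    rw [hzeq]; ext <;> simp [act, hu, hw] <;> ring
  have hwact : act (1 - q₁ * q₂) (-(q₁ * q₁)) (q₂ * q₂) (1 + q₁ * q₂) w = w := by
    ext <;> simp [act, hw] <;> ring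
  have iu : InvariantUnder (weight χ₁ χ₂) u := invariantUnder_weight χ₁ χ₂ (by simp [hu]) (by simp [hu])
  have iw : InvariantUnder (weight χ₁ χ₂) w := invariantUnder_weight χ₁ χ₂ (by simp [hw]) (by simp [hw])
  have vu : VanishesAlong (weight χ₁ χ₂) K u := vanishesAlong_base χ₁ χ₂ hq₁ hχ₁ hq₁K
  have vz : VanishesAlong (weight χ₁ χ₂) K z :=
    hzact ▸ VanishesAlong.act hper hdet hact vu
  have duw : det₂ u w = -(q₁ * q₂) := by simp [det₂, hu, hw]
  have hm : (-(q₁ * q₂) : ℤ) ≠ 0 := neg_ne_zero.2 (mul_ne_zero hz₁ hz₂)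
  have hwz : dedekindSymbol (weight χ₁ χ₂) K w z = dedekindSymbol (weight χ₁ χ₂) K w u := by
    have := dedekindSymbol_act hper hdet hact (u := w) (w := u) fun _ => by
      rw [det₂_swap u, duw, neg_neg]
      exact_mod_cast hN
    rwa [hzact, hwact, one_mul] at this
  have dww : det₂ u ((-(q₁ * q₂) : ℤ) • w) = K := by
    rw [det₂_smul_right, duw, hKdef]; push_cast; ring
  have dwz : det₂ w z = q₁ * q₂ := by
    rw [← hzact, ← congrArg (det₂ · _) hwact, det₂_act hdet, det₂_swap u w, duw, neg_neg]
  have hKd : ((q₁ * q₂ : ℤ) * (q₁ * q₂)) ∣ (K : ℤ) := ⟨1, by rw [hKdef]; push_cast; ring⟩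
  have h3 := dedekindSymbol_three_term iu (iw.smul (-(q₁ * q₂))) (z := -z) (K := K)
    (by rw [hzeq, neg_smul]; abel) h00 (by rw [dww]; exact_mod_cast hK.ne')
  rw [dww, vu.bern2 dvd_rfl] at h3
  have hvz : VanishesAlong (weight χ₁ χ₂) K (-z) := by simpa using vz.smul (-1)
  rw [hvz.bern2 dvd_rfl, dedekindSymbol_smul_right hper iw hm (by
      rw [duw, neg_mul_neg]; exact hKd),
    dedekindSymbol_smul_left hper iw hm (by
      rw [show det₂ w (-z) = -det₂ w z by simp [det₂]; ring, dwz, neg_mul_neg]; exact hKd),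
    dedekindSymbol_neg_right, dedekindSymbol_neg_left, hwz, dedekindSymbol_swap _ _ u w,
    dedekindSymbol_swap _ _ u z] at h3
  have hS := SGamma_eq_dedekindSymbol χ₁ χ₂ (γ := parabolic q₁ q₂) hq₁ hK hq₁K
    (by simp [parabolic]) fun _ => by
      simp only [parabolic, Matrix.of_apply, Matrix.cons_val', Matrix.cons_val_zero,
        Matrix.cons_val_one, Matrix.cons_val_fin_one]
      exact (neg_dvd.2 (Dvd.intro (q₁ : ℤ) (by rw [hKdef]; push_cast; ring)))
  rw [hS]
  have hb : ∀ a b : ℤ, bern2 ((det₂ (a, b) ((-(q₁ * q₂) : ℤ) • w) : ℝ) / (K : ℤ)) =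
      bern2 ((a : ℝ) / q₁ + (b : ℝ) / q₂) := fun a b => by
    have r₁ : (q₁ : ℝ) ≠ 0 := by exact_mod_cast hq₁.ne'
    have r₂ : (q₂ : ℝ) ≠ 0 := by exact_mod_cast hq₂'.ne'
    rw [← bern2_neg]
    congr 1
    rw [det₂_smul_right]
    simp only [det₂, hw, hKdef]
    push_cast
    field_simp
    ring
  simp only [hb] at h3
  rw [← hz, ← hu]
  have hKc : ((K : ℤ) : ℂ) = (q₁ * q₂) ^ 2 := by rw [hKdef]; push_cast; ring
  rw [hKc] at h3
  linear_combination -h3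

theorem SGamma_parabolic_ne_zero (hq₁ : 1 < q₁) (hq₂ : 1 < q₂)
    (hχ₁ : χ₁.IsPrimitive) (hχ₂ : χ₂.IsPrimitive) (hpar : χ₁ (-1) * χ₂ (-1) = 1) :
    SGamma χ₁ χ₂ (parabolic q₁ q₂) ≠ 0 := by
  have : NeZero q₁ := ⟨by omega⟩
  have : NeZero q₂ := ⟨by omega⟩
  rw [SGamma_parabolic χ₁ χ₂ (by omega) hq₂ (ne_one_of_isPrimitive hq₁ hχ₁)]
  have hz₁ : (q₁ : ℂ) ≠ 0 := NeZero.ne _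
  have hz₂ : (q₂ : ℂ) ≠ 0 := NeZero.ne _
  refine neg_ne_zero.2 (mul_ne_zero
    (div_ne_zero (pow_ne_zero 2 (mul_ne_zero hz₁ hz₂)) two_ne_zero) fun h => ?_)
  have hp := pmean_eq_of_periods (p := q₁) (r := q₂) (K := (q₁ * q₂) ^ 2) (by positivity)
    ((dvd_mul_right _ _).trans (dvd_pow_self _ two_ne_zero))
    ((dvd_mul_left _ _).trans (dvd_pow_self _ two_ne_zero))
    (g := fun a b => weight χ₁ χ₂ a b * (bern2 ((a : ℝ) / q₁ + (b : ℝ) / q₂) : ℂ)) (by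
      intro a a' b b' ha hb
      obtain ⟨s, hs⟩ := div_sub_div_int ha
      obtain ⟨t, ht⟩ := div_sub_div_int hb
      push_cast at hs ht
      rw [weight_congr χ₁ χ₂ ha hb, bern2_eq_of_sub (x := (a : ℝ) / q₁ + (b : ℝ) / q₂)
        (y := (a' : ℝ) / q₁ + (b' : ℝ) / q₂) (s + t)]
      push_cast
      linear_combination hs + ht)
  rw [h, mul_zero, Finset.sum_comm] at hp
  refine sum_bern2_ne_zero hq₁ hχ₁ hχ₂ hpar (Eq.trans ?_ hp.symm)
  rw [sum_range_eq_sum_zmod fun a => ∑ b ∈ Finset.range q₂,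
    weight χ₁ χ₂ a b * (bern2 ((a : ℝ) / q₁ + ((b : ℤ) : ℝ) / q₂) : ℂ)]
  refine Finset.sum_congr rfl fun x _ => ?_
  rw [sum_range_eq_sum_zmod fun b =>
    weight χ₁ χ₂ (x.val : ℤ) b * (bern2 (((x.val : ℤ) : ℝ) / q₁ + (b : ℝ) / q₂) : ℂ)]
  refine Finset.sum_congr rfl fun y _ => ?_
  simp only [weight, Int.cast_natCast, ZMod.natCast_zmod_val, conj_eq_inv]
  ring

end

theorem sum_mul_sawtooth_of_periodic {k : ℕ} (hk : 0 < k) {l : ℕ} (hl : 0 < l) {F : ℤ → ℂ}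
    (hF : ∀ a b : ℤ, a ≡ b [ZMOD k] → F a = F b) :
    ∑ j ∈ Finset.range (k * l), F j * (sawtooth ((j : ℝ) / (k * l : ℕ)) : ℂ) =
      ∑ j ∈ Finset.range k, F j * (sawtooth ((j : ℝ) / k) : ℂ) := by
  rw [sum_range_mul_add k l fun j => F j * (sawtooth ((j : ℝ) / (k * l : ℕ)) : ℂ)]
  refine Finset.sum_congr rfl fun j _ => ?_
  have hk' : (k : ℝ) ≠ 0 := by exact_mod_cast hk.ne'
  have hl' : (l : ℝ) ≠ 0 := by exact_mod_cast hl.ne'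
  have h : ∀ i : ℕ, F ((j + k * i : ℕ) : ℤ) * (sawtooth (((j + k * i : ℕ) : ℝ) / (k * l : ℕ)) : ℂ) =
      F j * (sawtooth (((j : ℝ) / k + i) / l) : ℂ) := fun i => by
    rw [hF ((j + k * i : ℕ) : ℤ) j (Int.modEq_iff_dvd.2 ⟨-i, by push_cast; ring⟩)]
    congr 3
    push_cast
    field_simp
  simp only [h]
  rw [← Finset.mul_sum, ← Complex.ofReal_sum, sum_sawtooth_div hl]

theorem sum_range_mul_ite_dvd {k l : ℕ} (hl : 0 < l) (G : ℕ → ℂ) :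
    (∑ j ∈ Finset.range (k * l), if l ∣ j then G j else 0) = ∑ j ∈ Finset.range k, G (l * j) := by
  rw [← Finset.sum_filter]
  symm
  refine Finset.sum_nbij (fun j => l * j) ?_ ?_ ?_ fun _ _ => rfl
  · intro j hj
    simp only [Finset.mem_range, Finset.mem_filter, dvd_mul_right, and_true, mul_comm k] at hj ⊢
    exact Nat.mul_lt_mul_of_pos_left hj hl
  · intro a _ b _ hab
    exact Nat.eq_of_mul_eq_mul_left hl hab
  · intro j hj
    simp only [Finset.coe_filter, Finset.mem_range, Set.mem_ofPred, mul_comm k] at hj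
    obtain ⟨hj, i, rfl⟩ := hj
    exact ⟨i, by simpa using Nat.lt_of_mul_lt_mul_left hj, rfl⟩

/-- The character twist of the sawtooth function by `χ̄`. -/
noncomputable def twistedSawtooth {q : ℕ} (χ : DirichletCharacter ℂ q) (y : ℝ) : ℂ :=
  ∑ n ∈ Finset.range q, (starRingEnd ℂ) (χ (n : ZMod q)) * (sawtooth ((n : ℝ) / q + y) : ℂ)

section

variable {q : ℕ} (χ : DirichletCharacter ℂ q)

theorem twistedSawtooth_eq_of_sub {x y : ℝ} (n : ℤ) (h : x - y = n) :
    twistedSawtooth χ x = twistedSawtooth χ y := by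
  unfold twistedSawtooth
  refine Finset.sum_congr rfl fun m _ => ?_
  rw [sawtooth_eq_of_sub (x := (m : ℝ) / q + x) (y := (m : ℝ) / q + y) n (by linarith)]

theorem sum_sawtooth_mul_add {l : ℕ} (hl : l.Coprime q) (y : ℝ) :
    ∑ n ∈ Finset.range q, (starRingEnd ℂ) (χ (n : ZMod q)) *
      (sawtooth (l * ((n : ℝ) / q) + y) : ℂ) = χ l * twistedSawtooth χ y := by
  have hper : ∀ a b : ℤ, a ≡ b [ZMOD q] →
      (starRingEnd ℂ) (χ (a : ZMod q)) * (sawtooth ((a : ℝ) / q + y) : ℂ) =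
        (starRingEnd ℂ) (χ (b : ZMod q)) * (sawtooth ((b : ℝ) / q + y) : ℂ) := by
    intro a b hab
    obtain ⟨s, hs⟩ := div_sub_div_int hab
    push_cast at hs
    rw [(ZMod.intCast_eq_intCast_iff _ _ _).2 hab,
      sawtooth_eq_of_sub (x := (a : ℝ) / q + y) (y := (b : ℝ) / q + y) s (by linarith)]
  have h := sum_range_comp hper (u := l) (Nat.isCoprime_iff_coprime.2 hl) 0
  simp only [add_zero, Int.cast_natCast] at h
  rw [twistedSawtooth, ← h, Finset.mul_sum]
  refine Finset.sum_congr rfl fun n _ => ?_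
  have hχ : χ l * (starRingEnd ℂ) (χ l) = 1 := by
    rw [conj_eq_inv, ← MulChar.mul_apply, mul_inv_cancel]
    exact MulChar.one_apply ((ZMod.isUnit_iff_coprime l q).2 hl)
  have e : ((l * n : ℤ) : ℝ) / q + y = l * ((n : ℝ) / q) + y := by push_cast; ring
  rw [e]
  push_cast
  rw [map_mul, map_mul]
  linear_combination (-(starRingEnd ℂ) (χ n) * (sawtooth (l * ((n : ℝ) / q) + y) : ℂ)) * hχ

theorem sum_twistedSawtooth_add {l : ℕ} (hl : l.Prime) (hlq : l.Coprime q)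
    (y : ℝ) (j : ℕ) :
    ∑ t ∈ Finset.range l, twistedSawtooth χ (y + t * j / l) =
      if l ∣ j then l * twistedSawtooth χ y else χ l * twistedSawtooth χ (l * y) := by
  have hl0 : (l : ℝ) ≠ 0 := by exact_mod_cast hl.ne_zero
  split_ifs with h
  · obtain ⟨i, rfl⟩ := h
    rw [Finset.sum_congr rfl fun (t : ℕ) _ => twistedSawtooth_eq_of_sub χ
      (x := y + t * (l * i : ℕ) / l) (y := y) (t * i) (by push_cast; field_simp; ring)]
    simp
  · rw [← sum_sawtooth_mul_add χ hlq]
    simp only [twistedSawtooth]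
    rw [Finset.sum_comm]
    refine Finset.sum_congr rfl fun n _ => ?_
    rw [← Finset.mul_sum]
    congr 1
    have hper : ∀ a b : ℤ, a ≡ b [ZMOD l] →
        (sawtooth ((l * ((n : ℝ) / q) + l * y + a) / l) : ℂ) =
          (sawtooth ((l * ((n : ℝ) / q) + l * y + b) / l) : ℂ) := by
      intro a b hab
      obtain ⟨s, hs⟩ := div_sub_div_int hab
      push_cast at hs
      rw [sawtooth_eq_of_sub (x := (l * ((n : ℝ) / q) + l * y + a) / l)
        (y := (l * ((n : ℝ) / q) + l * y + b) / l) s (by rw [← hs]; ring)]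
    have hs := sum_range_comp hper (u := j)
      (Nat.isCoprime_iff_coprime.2 ((hl.coprime_iff_not_dvd.2 h).symm)) 0
    simp only [Int.cast_natCast, add_zero] at hs
    rw [← sum_sawtooth_div hl.pos, Complex.ofReal_sum, ← hs]
    refine Finset.sum_congr rfl fun t _ => ?_
    congr 2
    push_cast
    field_simp
    ring

end

section

variable {q₁ q₂ : ℕ} (χ₁ : DirichletCharacter ℂ q₁) (χ₂ : DirichletCharacter ℂ q₂)

theorem newformDedekindSum_eq_sum_twistedSawtooth (h : ℤ) (k : ℕ) :
    newformDedekindSum χ₁ χ₂ h k = ∑ j ∈ Finset.range k,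
      ((starRingEnd ℂ) (χ₂ (j : ZMod q₂)) * twistedSawtooth χ₁ (h * j / k)) *
        (sawtooth ((j : ℝ) / k) : ℂ) := by
  rw [newformDedekindSum_eq]
  refine Finset.sum_congr rfl fun j _ => ?_
  rw [twistedSawtooth, Finset.mul_sum, Finset.sum_mul]
  refine Finset.sum_congr rfl fun n _ => ?_
  simp only [weight, Int.cast_natCast]
  ring

theorem newformDedekindSum_congr {h h' : ℤ} {k : ℕ} (hh : h ≡ h' [ZMOD k]) :
    newformDedekindSum χ₁ χ₂ h k = newformDedekindSum χ₁ χ₂ h' k := by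
  rw [newformDedekindSum_eq_sum_twistedSawtooth, newformDedekindSum_eq_sum_twistedSawtooth]
  refine Finset.sum_congr rfl fun j _ => ?_
  obtain ⟨s, hs⟩ := div_sub_div_int hh
  push_cast at hs
  rw [twistedSawtooth_eq_of_sub χ₁ (x := h * j / k) (y := h' * j / k) (s * j)]
  push_cast
  rw [← hs]
  ring

theorem periodic_newform_row {k : ℕ} (hk : q₂ ∣ k) (h : ℤ) {a b : ℤ} (hab : a ≡ b [ZMOD k]) :
    (starRingEnd ℂ) (χ₂ (a : ZMod q₂)) * twistedSawtooth χ₁ (h * a / k) =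
      (starRingEnd ℂ) (χ₂ (b : ZMod q₂)) * twistedSawtooth χ₁ (h * b / k) := by
  obtain ⟨s, hs⟩ := div_sub_div_int hab
  push_cast at hs
  rw [(ZMod.intCast_eq_intCast_iff _ _ _).2 (hab.of_dvd (by exact_mod_cast hk)),
    twistedSawtooth_eq_of_sub χ₁ (x := h * a / k) (y := h * b / k) (h * s)]
  push_cast
  rw [← hs]
  ring

theorem newformDedekindSum_mul_mul {k l : ℕ} (hk : 0 < k) (hl : 0 < l) (hq : q₂ ∣ k) (h : ℤ) :
    newformDedekindSum χ₁ χ₂ (l * h) (k * l : ℕ) = newformDedekindSum χ₁ χ₂ h k := by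
  rw [newformDedekindSum_eq_sum_twistedSawtooth, newformDedekindSum_eq_sum_twistedSawtooth]
  have := sum_mul_sawtooth_of_periodic hk hl fun a b hab => periodic_newform_row χ₁ χ₂ hq h hab
  simp only [Int.cast_natCast] at this
  rw [← this]
  refine Finset.sum_congr rfl fun j _ => ?_
  have hl' : (l : ℝ) ≠ 0 := by exact_mod_cast hl.ne'
  congr 3
  push_cast
  rw [mul_assoc, mul_comm (k : ℝ), mul_div_mul_left _ _ hl']

/-- Newform Dedekind sums are eigenfunctions of the Hecke operators. -/
theorem sum_newformDedekindSum_add_mul {k l : ℕ} (hk : 0 < k) (hl : l.Prime) (hlq : l.Coprime q₁)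
    (hq : q₂ ∣ k) (h : ℤ) :
    ∑ t ∈ Finset.range l, newformDedekindSum χ₁ χ₂ (h + k * t) (k * l : ℕ) =
      (χ₁ l + l * (starRingEnd ℂ) (χ₂ l)) * newformDedekindSum χ₁ χ₂ h k -
        χ₁ l * (starRingEnd ℂ) (χ₂ l) * newformDedekindSum χ₁ χ₂ (l * h) k := by
  have hl' : (l : ℝ) ≠ 0 := by exact_mod_cast hl.ne_zero
  have hk' : (k : ℝ) ≠ 0 := by exact_mod_cast hk.ne'
  have hA := sum_mul_sawtooth_of_periodic hk hl.pos fun a b hab =>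
    periodic_newform_row χ₁ χ₂ hq h hab
  simp only [Int.cast_natCast] at hA
  simp only [newformDedekindSum_eq_sum_twistedSawtooth]
  rw [Finset.sum_comm]
  have hrow : ∀ j ∈ Finset.range (k * l), ∑ t ∈ Finset.range l,
      ((starRingEnd ℂ) (χ₂ (j : ZMod q₂)) *
        twistedSawtooth χ₁ ((h + k * t : ℤ) * j / (k * l : ℕ))) *
          (sawtooth ((j : ℝ) / (k * l : ℕ)) : ℂ) =
      χ₁ l * (((starRingEnd ℂ) (χ₂ (j : ZMod q₂)) * twistedSawtooth χ₁ (h * j / k)) *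
        (sawtooth ((j : ℝ) / (k * l : ℕ)) : ℂ)) +
      if l ∣ j then (starRingEnd ℂ) (χ₂ (j : ZMod q₂)) * (sawtooth ((j : ℝ) / (k * l : ℕ)) : ℂ) *
        (l * twistedSawtooth χ₁ (h * j / (k * l : ℕ)) - χ₁ l * twistedSawtooth χ₁ (h * j / k))
      else 0 := by
    intro j _
    rw [← Finset.sum_mul, ← Finset.mul_sum]
    have e1 : ∀ t : ℕ, ((h + k * t : ℤ) : ℝ) * j / (k * l : ℕ) =
        h * j / (k * l : ℕ) + t * j / l := fun t => by
      push_cast; field_simp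
    have e2 : (l : ℝ) * (h * j / (k * l : ℕ)) = h * j / k := by push_cast; field_simp
    simp only [e1]
    rw [sum_twistedSawtooth_add χ₁ hl hlq, e2]
    split_ifs <;> ring
  rw [Finset.sum_congr rfl hrow, Finset.sum_add_distrib, ← Finset.mul_sum, hA,
    sum_range_mul_ite_dvd hl.pos fun j => (starRingEnd ℂ) (χ₂ (j : ZMod q₂)) *
      (sawtooth ((j : ℝ) / (k * l : ℕ)) : ℂ) *
        (l * twistedSawtooth χ₁ (h * j / (k * l : ℕ)) - χ₁ l * twistedSawtooth χ₁ (h * j / k)),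
    add_mul, add_sub_assoc]
  congr 1
  rw [Finset.mul_sum, Finset.mul_sum, ← Finset.sum_sub_distrib]
  refine Finset.sum_congr rfl fun j _ => ?_
  have e1 : ((l * j : ℕ) : ℝ) / (k * l : ℕ) = j / k := by push_cast; field_simp
  have e2 : (h : ℝ) * (l * j : ℕ) / (k * l : ℕ) = h * j / k := by push_cast; field_simp
  have e3 : (h : ℝ) * (l * j : ℕ) / k = (l * h : ℤ) * j / k := by push_cast; ring
  rw [e1, e2, e3, Nat.cast_mul, map_mul, map_mul]
  ring

end

open CongruenceSubgroup

theorem mul_entry_zero_zero (γ δ : Matrix.SpecialLinearGroup (Fin 2) ℤ) :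
    (γ * δ).1 0 0 = γ.1 0 0 * δ.1 0 0 + γ.1 0 1 * δ.1 1 0 := by
  simp [Matrix.mul_apply, Fin.sum_univ_two]

theorem mul_entry_one_one (γ δ : Matrix.SpecialLinearGroup (Fin 2) ℤ) :
    (γ * δ).1 1 1 = γ.1 1 0 * δ.1 0 1 + γ.1 1 1 * δ.1 1 1 := by
  simp [Matrix.mul_apply, Fin.sum_univ_two]

theorem entries_of_mem_Gamma1 {N : ℕ} {γ : Matrix.SpecialLinearGroup (Fin 2) ℤ}
    (hγ : γ ∈ Gamma1 N) :
    γ.1 0 0 ≡ 1 [ZMOD N] ∧ γ.1 1 1 ≡ 1 [ZMOD N] ∧ (N : ℤ) ∣ γ.1 1 0 := by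
  obtain ⟨h1, h2, h3⟩ := (Gamma1_mem N γ).1 hγ
  refine ⟨(ZMod.intCast_eq_intCast_iff _ _ _).1 ?_, (ZMod.intCast_eq_intCast_iff _ _ _).1 ?_,
    (ZMod.intCast_zmod_eq_zero_iff_dvd _ _).1 h3⟩
  · simpa using h1
  · simpa using h2

theorem conj_mem_Gamma1 {N : ℕ} {g γ : Matrix.SpecialLinearGroup (Fin 2) ℤ}
    (hg : g ∈ Gamma0 N) (hγ : γ ∈ Gamma1 N) : g * γ * g⁻¹ ∈ Gamma1 N := by
  have h0 : g * γ * g⁻¹ ∈ Gamma0 N := mul_mem (mul_mem hg (Gamma1_in_Gamma0 N hγ)) (inv_mem hg)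
  have hγ' := (Gamma1_mem N γ).1 hγ
  have hg' := Gamma0_mem.1 hg
  have hi := Gamma0_mem.1 (inv_mem hg)
  have i00 : g⁻¹.1 0 0 = g.1 1 1 := by
    rw [Matrix.SpecialLinearGroup.SL2_inv_expl]; rfl
  have i11 : g⁻¹.1 1 1 = g.1 0 0 := by
    rw [Matrix.SpecialLinearGroup.SL2_inv_expl]; rfl
  have hdet : (g.1 0 0 : ZMod N) * g.1 1 1 = 1 := by
    have := congrArg (Int.cast : ℤ → ZMod N) (det_entries g)
    push_cast at this
    rw [hg', mul_zero, sub_zero] at this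
    exact this
  refine (Gamma1_mem N _).2 ⟨?_, ?_, Gamma0_mem.1 h0⟩
  · rw [mul_entry_zero_zero, mul_entry_zero_zero, i00]
    push_cast
    rw [hγ'.1, hγ'.2.2, hi]
    linear_combination hdet
  · rw [mul_entry_one_one, mul_entry_one_one, i11]
    have := Gamma0_mem.1 (mul_mem hg (Gamma1_in_Gamma0 N hγ))
    push_cast
    rw [hγ'.2.1, hg', this]
    linear_combination hdet

section

variable {q₁ q₂ : ℕ} (χ₁ : DirichletCharacter ℂ q₁) (χ₂ : DirichletCharacter ℂ q₂)

theorem weight_eq_one_of_mem {γ : Matrix.SpecialLinearGroup (Fin 2) ℤ}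
    (hγ : γ ∈ Gamma1 (q₁ * q₂)) : weight χ₁ χ₂ (γ.1 0 0) (γ.1 1 1) = 1 := by
  obtain ⟨h1, h2, -⟩ := entries_of_mem_Gamma1 hγ
  rw [weight_congr χ₁ χ₂ (h1.of_dvd (by push_cast; exact dvd_mul_right _ _))
    (h2.of_dvd (by push_cast; exact dvd_mul_left _ _)), weight_one]

theorem SGamma_one : SGamma χ₁ χ₂ 1 = 0 := by simp [SGamma]

variable (hq₁ : 0 < q₁) (hq₂ : 1 < q₂) (hχ₁ : χ₁ ≠ 1)

include hq₁ hq₂ hχ₁ in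
theorem SGamma_mul_of_mem_Gamma1 {γ γ' : Matrix.SpecialLinearGroup (Fin 2) ℤ}
    (hγ : γ ∈ Gamma1 (q₁ * q₂)) (hγ' : γ' ∈ Gamma0 (q₁ * q₂)) :
    SGamma χ₁ χ₂ (γ * γ') = SGamma χ₁ χ₂ γ + SGamma χ₁ χ₂ γ' := by
  rw [SGamma_mul χ₁ χ₂ hq₁ hq₂ hχ₁ (Gamma1_in_Gamma0 _ hγ) hγ', weight_eq_one_of_mem χ₁ χ₂ hγ,
    one_mul]

/-- The restriction of `SGamma` to `Γ₁(q₁q₂)`, as a homomorphism. -/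
noncomputable def SGammaHom : Additive (Gamma1 (q₁ * q₂)) →+ ℂ where
  toFun γ := SGamma χ₁ χ₂ (γ.toMul : Matrix.SpecialLinearGroup (Fin 2) ℤ)
  map_zero' := SGamma_one χ₁ χ₂
  map_add' γ γ' := SGamma_mul_of_mem_Gamma1 χ₁ χ₂ hq₁ hq₂ hχ₁ γ.toMul.2
    (Gamma1_in_Gamma0 _ γ'.toMul.2)

theorem coe_range_SGammaHom : ((SGammaHom χ₁ χ₂ hq₁ hq₂ hχ₁).range : Set ℂ) =
    SGamma χ₁ χ₂ '' (Gamma1 (q₁ * q₂) : Set (Matrix.SpecialLinearGroup (Fin 2) ℤ)) := by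
  ext x
  constructor
  · rintro ⟨γ, rfl⟩
    exact ⟨_, γ.toMul.2, rfl⟩
  · rintro ⟨γ, hγ, rfl⟩
    exact ⟨Additive.ofMul ⟨γ, hγ⟩, rfl⟩

instance : Group.FG (Matrix.SpecialLinearGroup (Fin 2) ℤ) :=
  ⟨⟨{ModularGroup.S, ModularGroup.T}, by
    simpa using SpecialLinearGroup.SL2Z_generators⟩⟩

theorem finite_range_SGammaHom : Module.Finite ℤ (SGammaHom χ₁ χ₂ hq₁ hq₂ hχ₁).range := by
  have : NeZero (q₁ * q₂) := ⟨(Nat.mul_pos hq₁ (by omega)).ne'⟩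
  have : Group.FG (Gamma1 (q₁ * q₂)) := Subgroup.fg_of_index_ne_zero _
  rw [Module.Finite.iff_addGroup_fg]
  exact AddGroup.fg_range _

theorem newformDedekindSum_mem_image {h : ℤ} {k : ℕ} (hk : 0 < k) (hN : q₁ * q₂ ∣ k)
    (h1 : h ≡ 1 [ZMOD (q₁ * q₂ : ℕ)]) (hc : IsCoprime h k) :
    newformDedekindSum χ₁ χ₂ h k ∈ SGamma χ₁ χ₂ ''
      (Gamma1 (q₁ * q₂) : Set (Matrix.SpecialLinearGroup (Fin 2) ℤ)) := by
  obtain ⟨d, b, hdb⟩ := hc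
  refine ⟨⟨!![h, -b; (k : ℤ), d], by rw [Matrix.det_fin_two_of]; linear_combination hdb⟩, ?_, ?_⟩
  · have hh : (h : ZMod (q₁ * q₂)) = 1 := by
      simpa using (ZMod.intCast_eq_intCast_iff _ _ _).2 h1
    have hk0 : (k : ZMod (q₁ * q₂)) = 0 := (ZMod.natCast_eq_zero_iff _ _).2 hN
    refine (Gamma1_mem _ _).2 ⟨by simpa using hh, ?_, by simpa using hk0⟩
    have := congrArg (Int.cast : ℤ → ZMod (q₁ * q₂)) hdb
    push_cast at this
    rw [hh, hk0, mul_one, mul_zero, add_zero] at this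
    simpa using this
  · have : (0 : ℤ) < k := by exact_mod_cast hk
    simp [SGamma, hk]

/-- The rational span of the values on `Γ₁(q₁q₂)`. -/
noncomputable def valueSpan : Submodule ℚ ℂ :=
  Submodule.span ℚ (SGamma χ₁ χ₂ ''
    (Gamma1 (q₁ * q₂) : Set (Matrix.SpecialLinearGroup (Fin 2) ℤ)))

theorem conj_mul_newformDedekindSum_mem {h : ℤ} {k : ℕ} (hk : 0 < k)
    (hN : q₁ * q₂ ∣ k) (h1 : h ≡ 1 [ZMOD (q₁ * q₂ : ℕ)]) (hc : IsCoprime h k)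
    {x : ℕ} (hx : x.Coprime k) :
    (starRingEnd ℂ) (χ₂ x) * newformDedekindSum χ₁ χ₂ h k ∈ valueSpan χ₁ χ₂ := by
  have hq₁k : q₁ ∣ k := (dvd_mul_right _ _).trans hN
  have hq₂k : q₂ ∣ k := (dvd_mul_left _ _).trans hN
  obtain ⟨r, s, hrs⟩ : IsCoprime (x : ℤ) k := Nat.isCoprime_iff_coprime.2 hx
  have key : ∀ l : ℕ, l.Prime → x < l → l ≡ x [MOD k] →
      (χ₁ x + l * (starRingEnd ℂ) (χ₂ x)) * newformDedekindSum χ₁ χ₂ h k -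
        χ₁ x * (starRingEnd ℂ) (χ₂ x) * newformDedekindSum χ₁ χ₂ (x * h) k -
          newformDedekindSum χ₁ χ₂ (r * h) k ∈ valueSpan χ₁ χ₂ := by
    intro l hl _ hlx
    have hlk : l.Coprime k := by
      rw [Nat.Coprime, hlx.gcd_eq]; exact hx
    have c₁ : (l : ZMod q₁) = x := (ZMod.natCast_eq_natCast_iff _ _ _).2 (hlx.of_dvd hq₁k)
    have c₂ : (l : ZMod q₂) = x := (ZMod.natCast_eq_natCast_iff _ _ _).2 (hlx.of_dvd hq₂k)
    have hlx' : (l : ℤ) ≡ x [ZMOD k] := Int.natCast_modEq_iff.2 hlx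
    have hT := sum_newformDedekindSum_add_mul χ₁ χ₂ hk hl (hlk.coprime_dvd_right hq₁k) hq₂k h
    rw [c₁, c₂, newformDedekindSum_congr χ₁ χ₂ (hlx'.mul_right h)] at hT
    rw [← hT]
    obtain ⟨m, n, hmn⟩ : IsCoprime (l : ℤ) k := Nat.isCoprime_iff_coprime.2 hlk
    have hlz : (l : ℤ) ≠ 0 := by exact_mod_cast hl.ne_zero
    set t₀ : ℕ := ((-n * h) % l).toNat with ht₀
    have ht₀' : (t₀ : ℤ) = (-n * h) % l := Int.toNat_of_nonneg (Int.emod_nonneg _ hlz)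
    have ht₀l : t₀ < l := by
      have := Int.emod_lt_of_pos (-n * h) (by exact_mod_cast hl.pos : (0 : ℤ) < l)
      omega
    have hdvd : (l : ℤ) ∣ h + k * t₀ := by
      rw [ht₀', Int.emod_def]
      exact ⟨m * h - k * ((-n * h) / l), by linear_combination -h * hmn⟩
    rw [← Finset.add_sum_erase _ _ (Finset.mem_range.2 ht₀l)]
    have hterm : newformDedekindSum χ₁ χ₂ (h + k * t₀) (k * l : ℕ) =
        newformDedekindSum χ₁ χ₂ (r * h) k := by
      obtain ⟨h', hh'⟩ := hdvd
      rw [hh', newformDedekindSum_mul_mul χ₁ χ₂ hk hl.pos hq₂k]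
      apply newformDedekindSum_congr
      have e1 : r * l ≡ 1 [ZMOD k] := (hlx'.mul_left r).trans
        (Int.modEq_iff_dvd.2 ⟨s, by linear_combination -hrs⟩)
      have e2 : l * h' ≡ h [ZMOD k] := by
        rw [← hh']; exact Int.modEq_iff_dvd.2 ⟨-t₀, by ring⟩
      calc h' = 1 * h' := (one_mul _).symm
        _ ≡ r * l * h' [ZMOD k] := (e1.mul_right h').symm
        _ = r * (l * h') := by ring
        _ ≡ r * h [ZMOD k] := e2.mul_left r
    rw [hterm, add_sub_cancel_left]
    refine Submodule.sum_mem _ fun t ht => Submodule.subset_span ?_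
    obtain ⟨hne, htl⟩ := Finset.mem_erase.1 ht
    have htl := Finset.mem_range.1 htl
    refine newformDedekindSum_mem_image χ₁ χ₂ (Nat.mul_pos hk hl.pos) (hN.mul_right l) ?_ ?_
    · refine Int.ModEq.trans (Int.modEq_iff_dvd.2 ?_) h1
      rw [show h - (h + k * t) = k * -t by ring]
      exact Dvd.dvd.mul_right (by exact_mod_cast hN) _
    · push_cast
      refine IsCoprime.mul_right ?_ ?_
      · simpa [add_comm] using hc.add_mul_left_left (t : ℤ)
      · refine IsCoprime.symm ((Nat.prime_iff_prime_int.1 hl).coprime_iff_not_dvd.2 fun hd => hne ?_)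
        have h3 : (l : ℤ) ∣ k * ((t : ℤ) - t₀) := by
          have := dvd_sub hd hdvd
          rwa [show h + k * (t : ℤ) - (h + k * t₀) = k * (t - t₀) by ring] at this
        have h4 : (l : ℤ) ∣ (t : ℤ) - t₀ :=
          (Nat.isCoprime_iff_coprime.2 hlk : IsCoprime (l : ℤ) k).dvd_of_dvd_mul_left h3
        have h5 := Int.eq_zero_of_abs_lt_dvd h4 (by rw [abs_lt]; omega)
        omega
  obtain ⟨l, hlx, hl, hlm⟩ := Nat.forall_exists_prime_gt_and_modEq x hk.ne' hx
  obtain ⟨l', hlx', hl', hlm'⟩ := Nat.forall_exists_prime_gt_and_modEq l hk.ne' hx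
  have hdiff := Submodule.sub_mem _ (key l' hl' (by omega) hlm') (key l hl hlx hlm)
  have hne : ((l' : ℚ) - l) ≠ 0 := sub_ne_zero.2 (by exact_mod_cast hlx'.ne')
  have := Submodule.smul_mem _ ((l' : ℚ) - l)⁻¹ hdiff
  convert this using 1
  rw [eq_inv_smul_iff₀ hne, Rat.smul_def]
  push_cast
  ring

end

/-- The multiplier ring of a finite-dimensional rational subspace of `ℂ` is a field. -/
def multiplierField (V : Submodule ℚ ℂ) [FiniteDimensional ℚ V] : Subfield ℂ where
  carrier := {z | ∀ v ∈ V, z * v ∈ V}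
  mul_mem' {a b} ha hb v hv := by
    rw [mul_assoc]; exact ha _ (hb _ hv)
  one_mem' v hv := by rwa [one_mul]
  add_mem' {a b} ha hb v hv := by
    rw [add_mul]; exact add_mem (ha _ hv) (hb _ hv)
  zero_mem' v _ := by rw [zero_mul]; exact zero_mem _
  neg_mem' {a} ha v hv := by rw [neg_mul]; exact neg_mem (ha _ hv)
  inv_mem' a ha v hv := by
    rcases eq_or_ne a 0 with rfl | h0
    · rw [inv_zero, zero_mul]; exact zero_mem _
    · have hinj : Function.Injective ((LinearMap.mulLeft ℚ a).restrict ha) := by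
        intro x y h
        exact Subtype.ext (mul_left_cancel₀ h0 (congrArg Subtype.val h))
      obtain ⟨w, hw⟩ := LinearMap.injective_iff_surjective.1 hinj ⟨v, hv⟩
      have hw' : a * (w : ℂ) = v := congrArg Subtype.val hw
      rw [← hw', inv_mul_cancel_left₀ h0]
      exact w.2

theorem span_rat_coe_eq_span_range {ι : Type*} {H : AddSubgroup ℂ} (b : Module.Basis ι ℤ H) :
    Submodule.span ℚ (H : Set ℂ) = Submodule.span ℚ (Set.range fun i => (b i : ℂ)) := by
  refine le_antisymm (Submodule.span_le.2 fun x hx => ?_)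
    (Submodule.span_mono (Set.range_subset_iff.2 fun i => (b i).2))
  have h := congrArg (Subtype.val : H → ℂ) (b.linearCombination_repr ⟨x, hx⟩)
  rw [Finsupp.linearCombination_apply, Finsupp.sum, AddSubgroup.val_finsetSum] at h
  rw [← show _ = x from h]
  refine Submodule.sum_mem _ fun i _ => ?_
  rw [AddSubgroup.coe_zsmul]
  exact zsmul_mem (Submodule.subset_span (Set.mem_range_self i)) _

theorem linearIndependent_rat_coe {ι : Type*} {H : AddSubgroup ℂ} (b : Module.Basis ι ℤ H) :
    LinearIndependent ℚ fun i => (b i : ℂ) := by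
  rw [← LinearIndependent.iff_fractionRing ℤ ℚ]
  exact b.linearIndependent.map' H.subtype.toIntLinearMap
    (LinearMap.ker_eq_bot.2 Subtype.val_injective)

theorem finrank_int_eq_finrank_span_rat (H : AddSubgroup ℂ) [Module.Finite ℤ H] :
    Module.finrank ℤ H = Module.finrank ℚ (Submodule.span ℚ (H : Set ℂ)) := by
  have b := Module.Free.chooseBasis ℤ H
  rw [span_rat_coe_eq_span_range b, finrank_span_eq_card (linearIndependent_rat_coe b),
    Module.finrank_eq_card_basis b]

theorem finiteDimensional_span_rat (H : AddSubgroup ℂ) [Module.Finite ℤ H] :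
    FiniteDimensional ℚ (Submodule.span ℚ (H : Set ℂ)) := by
  have b := Module.Free.chooseBasis ℤ H
  rw [span_rat_coe_eq_span_range b]
  exact FiniteDimensional.span_of_finite ℚ (Set.finite_range _)

section

variable {q₁ q₂ : ℕ} (χ₁ : DirichletCharacter ℂ q₁) (χ₂ : DirichletCharacter ℂ q₂)

theorem SGamma_inv (hq₁ : 0 < q₁) (hq₂ : 1 < q₂) (hχ₁ : χ₁ ≠ 1)
    {γ : Matrix.SpecialLinearGroup (Fin 2) ℤ} (hγ : γ ∈ Gamma1 (q₁ * q₂)) :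
    SGamma χ₁ χ₂ γ⁻¹ = -SGamma χ₁ χ₂ γ := by
  have h := SGamma_mul_of_mem_Gamma1 χ₁ χ₂ hq₁ hq₂ hχ₁ (inv_mem hγ) (Gamma1_in_Gamma0 _ hγ)
  rw [inv_mul_cancel, SGamma_one] at h
  exact eq_neg_of_add_eq_zero_left h.symm

theorem conj_mul_SGamma_mem_of_pos {γ : Matrix.SpecialLinearGroup (Fin 2) ℤ}
    (hγ : γ ∈ Gamma1 (q₁ * q₂)) (hc : 0 < γ.1 1 0) {r : ZMod q₂} (hr : IsUnit r) :
    (starRingEnd ℂ) (χ₂ r) * SGamma χ₁ χ₂ γ ∈ valueSpan χ₁ χ₂ := by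
  obtain ⟨k, hk⟩ := Int.eq_ofNat_of_zero_le hc.le
  obtain ⟨h1, -, hdvd⟩ := entries_of_mem_Gamma1 hγ
  have hk0 : 0 < k := by omega
  have hN : q₁ * q₂ ∣ k := by rw [hk] at hdvd; exact_mod_cast hdvd
  have : NeZero k := ⟨hk0.ne'⟩
  have hq₂k : q₂ ∣ k := (dvd_mul_left _ _).trans hN
  obtain ⟨x, hx⟩ := ZMod.unitsMap_surjective hq₂k hr.unit
  have hxr : ((x.val.val : ℕ) : ZMod q₂) = r := by
    have := congrArg Units.val hx
    rw [ZMod.unitsMap_val, IsUnit.unit_spec] at this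
    rw [← this, ZMod.natCast_val]
  rw [SGamma, if_pos hc, hk, ← hxr]
  refine conj_mul_newformDedekindSum_mem χ₁ χ₂ hk0 hN h1 ?_ (ZMod.val_coe_unit_coprime x)
  exact ⟨γ.1 1 1, -γ.1 0 1, by rw [← hk]; linear_combination det_entries γ⟩

variable (hq₁ : 0 < q₁) (hq₂ : 1 < q₂) (hχ₁ : χ₁ ≠ 1)

include hq₁ hq₂ hχ₁

theorem conj_right_mul_mem {r : ZMod q₂} (hr : IsUnit r) {v : ℂ} (hv : v ∈ valueSpan χ₁ χ₂) :
    (starRingEnd ℂ) (χ₂ r) * v ∈ valueSpan χ₁ χ₂ := by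
  suffices h : valueSpan χ₁ χ₂ ≤
      (valueSpan χ₁ χ₂).comap (LinearMap.mulLeft ℚ ((starRingEnd ℂ) (χ₂ r))) from h hv
  refine Submodule.span_le.2 ?_
  rintro _ ⟨γ, hγ, rfl⟩
  change (starRingEnd ℂ) (χ₂ r) * SGamma χ₁ χ₂ γ ∈ valueSpan χ₁ χ₂
  rcases lt_trichotomy (γ.1 1 0) 0 with hc | hc | hc
  · have hc' : 0 < γ⁻¹.1 1 0 := by
      rw [Matrix.SpecialLinearGroup.SL2_inv_expl]; simpa using hc
    have := conj_mul_SGamma_mem_of_pos χ₁ χ₂ (inv_mem hγ) hc' hr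
    rw [SGamma_inv χ₁ χ₂ hq₁ hq₂ hχ₁ hγ, mul_neg] at this
    simpa using neg_mem this
  · simp [SGamma, hc]
  · exact conj_mul_SGamma_mem_of_pos χ₁ χ₂ hγ hc hr

theorem weight_mul_mem {g : Matrix.SpecialLinearGroup (Fin 2) ℤ} (hg : g ∈ Gamma0 (q₁ * q₂))
    {v : ℂ} (hv : v ∈ valueSpan χ₁ χ₂) :
    weight χ₁ χ₂ (g.1 0 0) (g.1 1 1) * v ∈ valueSpan χ₁ χ₂ := by
  suffices h : valueSpan χ₁ χ₂ ≤
      (valueSpan χ₁ χ₂).comap (LinearMap.mulLeft ℚ (weight χ₁ χ₂ (g.1 0 0) (g.1 1 1))) from h hv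
  refine Submodule.span_le.2 ?_
  rintro _ ⟨γ, hγ, rfl⟩
  refine Submodule.subset_span ⟨_, conj_mem_Gamma1 hg hγ, ?_⟩
  have h := SGamma_mul_of_mem_Gamma1 χ₁ χ₂ hq₁ hq₂ hχ₁ (conj_mem_Gamma1 hg hγ) hg
  rw [inv_mul_cancel_right, SGamma_mul χ₁ χ₂ hq₁ hq₂ hχ₁ hg (Gamma1_in_Gamma0 _ hγ),
    add_comm] at h
  exact (add_right_cancel h).symm

theorem conj_left_mul_mem {a : ZMod q₁} (ha : IsUnit a) {v : ℂ} (hv : v ∈ valueSpan χ₁ χ₂) :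
    (starRingEnd ℂ) (χ₁ a) * v ∈ valueSpan χ₁ χ₂ := by
  have : NeZero (q₁ * q₂) := ⟨(Nat.mul_pos hq₁ (by omega)).ne'⟩
  obtain ⟨u, hu⟩ := ZMod.unitsMap_surjective (dvd_mul_right q₁ q₂) ha.unit
  have hua : ((u.val.val : ℕ) : ZMod q₁) = a := by
    have := congrArg Units.val hu
    rw [ZMod.unitsMap_val, IsUnit.unit_spec] at this
    rw [← this, ZMod.natCast_val]
  set x := u.val.val
  obtain ⟨d, b, hdb⟩ : IsCoprime (x : ℤ) (q₁ * q₂ : ℕ) :=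
    Nat.isCoprime_iff_coprime.2 (ZMod.val_coe_unit_coprime u)
  have hxd : (x : ZMod q₂) * d = 1 := by
    have := congrArg (Int.cast : ℤ → ZMod q₂) hdb
    push_cast at this
    rw [ZMod.natCast_self, mul_zero, mul_zero, add_zero] at this
    rw [mul_comm, this]
  have h := conj_right_mul_mem χ₁ χ₂ hq₁ hq₂ hχ₁ (IsUnit.of_mul_eq_one _ hxd)
    (weight_mul_mem χ₁ χ₂ hq₁ hq₂ hχ₁ (g := ⟨!![(x : ℤ), -b; ((q₁ * q₂ : ℕ) : ℤ), d], by
      rw [Matrix.det_fin_two_of]; linear_combination hdb⟩) (Gamma0_mem.2 (by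
      change (((q₁ * q₂ : ℕ) : ℤ) : ZMod (q₁ * q₂)) = 0
      rw [Int.cast_natCast, ZMod.natCast_self])) hv)
  convert h using 1
  simp only [weight, Matrix.of_apply, Matrix.cons_val', Matrix.cons_val_zero, Matrix.cons_val_one,
    Matrix.cons_val_fin_one, Int.cast_natCast, hua]
  rw [← mul_assoc, ← mul_assoc, ← map_mul, ← map_mul, ← map_mul, hxd, map_one, one_mul]

omit hq₁ hq₂ hχ₁

theorem conj_range_subset {q : ℕ} (χ : DirichletCharacter ℂ q) (x : ZMod q) :
    (starRingEnd ℂ) (χ x) ∈ Set.range χ := by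
  rw [conj_eq_inv, MulChar.inv_apply]
  exact Set.mem_range_self _

theorem range_subset_of_conj_mem {q : ℕ} (χ : DirichletCharacter ℂ q) {K : Subfield ℂ}
    (h : ∀ x : ZMod q, IsUnit x → (starRingEnd ℂ) (χ x) ∈ K) : Set.range χ ⊆ K := by
  rintro _ ⟨x, rfl⟩
  by_cases hx : IsUnit x
  · obtain ⟨u, rfl⟩ := hx
    have := h _ (u⁻¹).isUnit
    rw [conj_eq_inv, MulChar.inv_apply, Ring.inverse_unit, inv_inv] at this
    exact this
  · rw [MulChar.map_nonunit _ hx]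
    exact zero_mem _

theorem sawtooth_ratCast (x : ℚ) : ∃ y : ℚ, sawtooth x = y := by
  unfold sawtooth
  split_ifs
  · exact ⟨0, by simp⟩
  · exact ⟨x - ⌊x⌋ - 1 / 2, by push_cast; rw [Rat.floor_cast]⟩

theorem newformDedekindSum_mem_Ffield (h k : ℤ) :
    newformDedekindSum χ₁ χ₂ h k ∈ Ffield χ₁ χ₂ := by
  refine sum_mem fun j _ => sum_mem fun n _ => ?_
  obtain ⟨y, hy⟩ := sawtooth_ratCast (j / k)
  obtain ⟨z, hz⟩ := sawtooth_ratCast (n / q₁ + h * j / k)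
  push_cast at hy hz
  rw [hy, hz, Complex.ofReal_ratCast, Complex.ofReal_ratCast]
  exact mul_mem (mul_mem (mul_mem
    (Subfield.subset_closure (Or.inr (conj_range_subset χ₂ _)))
    (Subfield.subset_closure (Or.inl (conj_range_subset χ₁ _)))) (SubfieldClass.ratCast_mem _ _)) (SubfieldClass.ratCast_mem _ _)

theorem SGamma_mem_Ffield (γ : Matrix.SpecialLinearGroup (Fin 2) ℤ) :
    SGamma χ₁ χ₂ γ ∈ Ffield χ₁ χ₂ := by
  unfold SGamma
  split_ifs
  · exact newformDedekindSum_mem_Ffield χ₁ χ₂ _ _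
  · exact newformDedekindSum_mem_Ffield χ₁ χ₂ _ _
  · exact zero_mem _

end

end NewformDedekind

open NewformDedekind in
/-- The image `S_{χ₁,χ₂}(Γ₁(q₁q₂))` is an additive subgroup of `ℂ` contained in
`F_{χ₁,χ₂}`, which is a lattice of full rank in `F_{χ₁,χ₂}`: it is a finitely generated
free `ℤ`-module of rank `[F_{χ₁,χ₂} : ℚ]`, and its `ℚ`-linear span is `F_{χ₁,χ₂}`. -/
theorem image_Gamma1_is_full_rank_lattice {q₁ q₂ : ℕ} (hq₁ : 1 < q₁) (hq₂ : 1 < q₂)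
    (χ₁ : DirichletCharacter ℂ q₁) (χ₂ : DirichletCharacter ℂ q₂)
    (hχ₁ : DirichletCharacter.IsPrimitive χ₁) (hχ₂ : DirichletCharacter.IsPrimitive χ₂)
    (hpar : χ₁ (-1) * χ₂ (-1) = 1) :
    ∃ H : AddSubgroup ℂ,
      (H : Set ℂ) = SGamma χ₁ χ₂ ''
          (CongruenceSubgroup.Gamma1 (q₁ * q₂) : Set (Matrix.SpecialLinearGroup (Fin 2) ℤ)) ∧
      (H : Set ℂ) ⊆ (Ffield χ₁ χ₂ : Set ℂ) ∧
      Module.Free ℤ H ∧ Module.Finite ℤ H ∧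
      Module.finrank ℤ H = Module.finrank ℚ (Ffield χ₁ χ₂) ∧
      (Submodule.span ℚ (H : Set ℂ) : Set ℂ) = (Ffield χ₁ χ₂ : Set ℂ) := by
  have hne := ne_one_of_isPrimitive hq₁ hχ₁
  have hq₁' : 0 < q₁ := by omega
  have hfin := finite_range_SGammaHom χ₁ χ₂ hq₁' hq₂ hne
  have hcoe := coe_range_SGammaHom χ₁ χ₂ hq₁' hq₂ hne
  set H := (SGammaHom χ₁ χ₂ hq₁' hq₂ hne).range
  have hV : Submodule.span ℚ (H : Set ℂ) = valueSpan χ₁ χ₂ := by rw [hcoe, valueSpan]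
  have hFV : FiniteDimensional ℚ (valueSpan χ₁ χ₂) := hV ▸ finiteDimensional_span_rat H
  have hsub : (H : Set ℂ) ⊆ (Ffield χ₁ χ₂ : Set ℂ) := by
    rw [hcoe]
    rintro _ ⟨γ, -, rfl⟩
    exact SGamma_mem_Ffield χ₁ χ₂ γ
  have hmul : Ffield χ₁ χ₂ ≤ multiplierField (valueSpan χ₁ χ₂) :=
    Subfield.closure_le.2 (Set.union_subset
      (range_subset_of_conj_mem χ₁ fun _ hx _ => conj_left_mul_mem χ₁ χ₂ hq₁' hq₂ hne hx)
      (range_subset_of_conj_mem χ₂ fun _ hx _ => conj_right_mul_mem χ₁ χ₂ hq₁' hq₂ hne hx))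
  have hspan : (Submodule.span ℚ (H : Set ℂ) : Set ℂ) = (Ffield χ₁ χ₂ : Set ℂ) := by
    refine subset_antisymm (fun x hx => ?_) fun x hx => ?_
    · refine Submodule.span_induction (p := fun x _ => x ∈ Ffield χ₁ χ₂) (fun x hx => hsub hx)
        (zero_mem _) (fun _ _ _ _ => add_mem) (fun a x _ hx => ?_) hx
      rw [Rat.smul_def]
      exact mul_mem (SubfieldClass.ratCast_mem _ _) hx
    · have h0 := SGamma_parabolic_ne_zero χ₁ χ₂ hq₁ hq₂ hχ₁ hχ₂ hpar
      have hmem : SGamma χ₁ χ₂ (parabolic q₁ q₂) ∈ valueSpan χ₁ χ₂ :=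
        Submodule.subset_span ⟨_, parabolic_mem q₁ q₂, rfl⟩
      rw [hV, ← div_mul_cancel₀ x h0]
      exact hmul (div_mem hx (SGamma_mem_Ffield χ₁ χ₂ _)) _ hmem
  refine ⟨H, hcoe, hsub, inferInstance, hfin, ?_, hspan⟩
  rw [finrank_int_eq_finrank_span_rat]
  let f : Submodule.span ℚ (H : Set ℂ) →ₗ[ℚ] Ffield χ₁ χ₂ :=
    { toFun x := ⟨x.1, hspan.subset x.2⟩
      map_add' _ _ := rfl
      map_smul' a x := Subtype.ext (Rat.smul_def a (x : ℂ)) }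
  have hf : Function.Bijective f :=
    ⟨fun x y h => Subtype.ext (congrArg (Subfield.subtype _) h),
      fun y => ⟨⟨y.1, hspan.superset y.2⟩, rfl⟩⟩
  exact (LinearEquiv.ofBijective f hf).finrank_eq
end

section
/- For all integers h, k, n with k > 0 and n > 0, Σ_{a,d > 0, ad = n} Σ_{b = 0}^{d−1} s(ah + bk, dk) = σ(n)·s(h,k), where σ(n) = Σ_{d | n} d is the sum-of-divisors function. -/
open scoped BigOperators

/-- The classical Dedekind sum `s(h,k) = Σ_{j mod k} B₁(j/k) B₁(hj/k)`,
defined for all integers `h` and `k ≥ 1`. -/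
noncomputable def dedekindSum (h k : ℤ) : ℝ :=
  ∑ j ∈ Finset.range k.toNat, sawtooth ((j : ℝ) / (k : ℝ)) * sawtooth ((h : ℝ) * (j : ℝ) / (k : ℝ))

lemma sawtooth_add_int (x : ℝ) (n : ℤ) : sawtooth (x + n) = sawtooth x := by
  unfold sawtooth
  have h : (∃ m : ℤ, x + n = (m : ℝ)) ↔ ∃ m : ℤ, x = (m : ℝ) := by
    constructor
    · rintro ⟨m, hm⟩
      exact ⟨m - n, by push_cast; linarith⟩
    · rintro ⟨m, rfl⟩
      exact ⟨m + n, by push_cast; ring⟩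
  by_cases hx : ∃ m : ℤ, x = (m : ℝ)
  · rw [if_pos (h.2 hx), if_pos hx]
  · rw [if_neg (mt h.1 hx), if_neg hx, Int.floor_add_intCast]
    push_cast
    ring

lemma sawtooth_zero : sawtooth 0 = 0 := by
  unfold sawtooth
  exact if_pos ⟨0, by simp⟩

lemma sawtooth_of_mem_Ioo {x : ℝ} (h0 : 0 < x) (h1 : x < 1) : sawtooth x = x - 1 / 2 := by
  unfold sawtooth
  have hf : ⌊x⌋ = 0 := Int.floor_eq_zero_iff.2 ⟨h0.le, h1⟩
  rw [if_neg, hf]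
  · simp
  · rintro ⟨n, rfl⟩
    simp only [Int.floor_intCast] at hf
    simp [hf] at h0

lemma sum_range_cast_div (m : ℕ) (hm : 0 < m) :
    ∑ t ∈ Finset.range m, (t : ℝ) / m = ((m : ℝ) - 1) / 2 := by
  have h : ∀ n : ℕ, ∑ t ∈ Finset.range n, (t : ℝ) = (n : ℝ) * (n - 1) / 2 := by
    intro n
    induction n with
    | zero => simp
    | succ n ih => rw [Finset.sum_range_succ, ih]; push_cast; ring
  have : (m : ℝ) ≠ 0 := by positivity
  rw [← Finset.sum_div, h]
  field_simp

/-- The distribution relation for the sawtooth function, on the fundamental interval. -/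
lemma sum_sawtooth_add_div_of_lt {m : ℕ} (hm : 0 < m) {x : ℝ} (h0 : 0 ≤ x) (h1 : m * x < 1) :
    ∑ t ∈ Finset.range m, sawtooth (x + t / m) = sawtooth (m * x) := by
  have hm' : (0 : ℝ) < m := by positivity
  have hlt : ∀ t ∈ Finset.range m, x + (t : ℝ) / m < 1 := by
    intro t ht
    have ht' : (t : ℝ) + 1 ≤ m := by exact_mod_cast Finset.mem_range.1 ht
    have : x + (t : ℝ) / m = (m * x + t) / m := by field_simp
    rw [this, div_lt_one hm']
    linarith
  have hsum := sum_range_cast_div m hm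
  rcases h0.eq_or_lt with rfl | h0
  · obtain ⟨m, rfl⟩ : ∃ l, m = l + 1 := ⟨m - 1, by omega⟩
    rw [Finset.sum_range_succ'] at hsum ⊢
    have : ∀ t ∈ Finset.range m, sawtooth (0 + ((t + 1 : ℕ) : ℝ) / (m + 1 : ℕ)) =
        ((t + 1 : ℕ) : ℝ) / (m + 1 : ℕ) - 1 / 2 := by
      intro t ht
      have := hlt (t + 1) (by simpa using ht)
      rw [sawtooth_of_mem_Ioo (by positivity) this, zero_add]
    rw [Finset.sum_congr rfl this, Finset.sum_sub_distrib]
    simp only [Nat.cast_zero, zero_div, add_zero, mul_zero, sawtooth_zero] at hsum ⊢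
    rw [hsum]
    simp
    ring
  · have : ∀ t ∈ Finset.range m, sawtooth (x + (t : ℝ) / m) = (x - 1 / 2) + (t : ℝ) / m := by
      intro t ht
      rw [sawtooth_of_mem_Ioo (by positivity) (hlt t ht)]
      ring
    rw [Finset.sum_congr rfl this, Finset.sum_add_distrib, hsum,
      sawtooth_of_mem_Ioo (by positivity) h1]
    simp
    ring

lemma sum_range_mod_eq_of_coprime {M : Type*} [AddCommMonoid M] {e i : ℕ} (he : 0 < e)
    (hi : i.Coprime e) (f : ℕ → M) :
    ∑ b ∈ Finset.range e, f (b * i % e) = ∑ b ∈ Finset.range e, f b := by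
  have hinj : Set.InjOn (fun b => b * i % e) (Finset.range e : Set ℕ) := by
    intro a ha b hb hab
    simp only [Finset.coe_range, Set.mem_Iio] at ha hb
    have h : a ≡ b [MOD e] := Nat.ModEq.cancel_right_of_coprime hi.symm hab
    exact h.eq_of_lt_of_lt ha hb
  have himg : (Finset.range e).image (fun b => b * i % e) = Finset.range e := by
    apply Finset.eq_of_subset_of_card_le
    · intro x hx
      obtain ⟨b, -, rfl⟩ := Finset.mem_image.1 hx
      exact Finset.mem_range.2 (Nat.mod_lt _ he)
    · rw [Finset.card_image_of_injOn hinj]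
  conv_rhs => rw [← himg]
  rw [Finset.sum_image hinj]

lemma sum_range_mul_eq {M : Type*} [AddCommMonoid M] (g e : ℕ) (f : ℕ → M) :
    ∑ b ∈ Finset.range (g * e), f b =
      ∑ t ∈ Finset.range g, ∑ r ∈ Finset.range e, f (r + e * t) := by
  induction g with
  | zero => simp
  | succ g ih =>
    rw [add_mul, one_mul, Finset.sum_range_add, ih, Finset.sum_range_succ]
    simp only [add_comm, mul_comm]

lemma sawtooth_add_mod_div {e : ℕ} (he : 0 < e) (x : ℝ) (c : ℕ) :
    sawtooth (x + ((c % e : ℕ) : ℝ) / e) = sawtooth (x + (c : ℝ) / e) := by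
  have he' : (e : ℝ) ≠ 0 := by positivity
  rw [← sawtooth_add_int _ ((c / e : ℕ) : ℤ)]
  congr 1
  have : ((e * (c / e) + c % e : ℕ) : ℝ) = c := by rw [Nat.div_add_mod]
  rw [Int.cast_natCast, ← this, Nat.cast_add, Nat.cast_mul]
  field_simp
  ring

/-- The distribution relation for the sawtooth function. -/
lemma sum_sawtooth_add_div {m : ℕ} (hm : 0 < m) (x : ℝ) :
    ∑ t ∈ Finset.range m, sawtooth (x + t / m) = sawtooth (m * x) := by
  have hm' : (0 : ℝ) < m := by positivity
  set q : ℤ := ⌊(m : ℝ) * x⌋ with hq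
  have h0 : (0 : ℝ) ≤ x - q / m := by
    rw [sub_nonneg, div_le_iff₀ hm', mul_comm]
    exact Int.floor_le _
  have heq : (m : ℝ) * (x - q / m) = m * x - q := by field_simp
  have h1 : (m : ℝ) * (x - q / m) < 1 := by
    rw [heq]
    linarith [Int.lt_floor_add_one ((m : ℝ) * x)]
  have key := sum_sawtooth_add_div_of_lt hm h0 h1
  rw [heq, ← sawtooth_add_int _ q, sub_add_cancel] at key
  rw [← key]
  obtain ⟨c, z, hcz⟩ : ∃ (c : ℕ) (z : ℤ), q = c + m * z := by
    refine ⟨(q % m).toNat, q / m, ?_⟩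
    rw [Int.toNat_of_nonneg (Int.emod_nonneg _ (by positivity)), Int.emod_add_mul_ediv]
  have hshift : ∀ t : ℕ, sawtooth (x + (t : ℝ) / m) =
      sawtooth (x - q / m + ((t + c : ℕ) : ℝ) / m) := by
    intro t
    rw [← sawtooth_add_int (x - q / m + ((t + c : ℕ) : ℝ) / m) z, hcz]
    congr 1
    push_cast
    field_simp
    ring
  have hrot : ∀ (f : ℕ → ℝ), (∀ t, f (t + m) = f t) → ∀ c : ℕ,
      ∑ t ∈ Finset.range m, f (t + c) = ∑ t ∈ Finset.range m, f t := by
    intro f hf c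
    induction c with
    | zero => rfl
    | succ c ih =>
      rw [← ih]
      have h2 := Finset.sum_range_succ (fun t => f (t + c)) m
      rw [Finset.sum_range_succ'] at h2
      have h3 : f (m + c) = f (0 + c) := by rw [add_comm m, hf, zero_add]
      rw [h3] at h2
      simpa only [add_assoc, add_comm 1] using add_right_cancel h2
  rw [Finset.sum_congr rfl fun t _ => hshift t]
  refine hrot (fun t => sawtooth (x - q / m + (t : ℝ) / m)) (fun t => ?_) c
  rw [← sawtooth_add_mod_div hm, Nat.add_mod_right, sawtooth_add_mod_div hm]

lemma sum_sawtooth_add_mul_div {g e i : ℕ} (he : 0 < e) (hi : i.Coprime e) (x : ℝ) :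
    ∑ b ∈ Finset.range (g * e), sawtooth (x + ((b * i : ℕ) : ℝ) / e) =
      g * sawtooth (e * x) := by
  rw [sum_range_mul_eq]
  have h : ∀ t ∈ Finset.range g, ∑ r ∈ Finset.range e,
      sawtooth (x + (((r + e * t) * i : ℕ) : ℝ) / e) = sawtooth (e * x) := by
    intro t _
    rw [← sum_sawtooth_add_div he,
      ← sum_range_mod_eq_of_coprime he hi (fun b => sawtooth (x + (b : ℝ) / e))]
    refine Finset.sum_congr rfl fun r _ => ?_
    rw [← sawtooth_add_mod_div he]
    congr 4
    rw [add_mul, mul_assoc, Nat.add_mul_mod_self_left]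
  rw [Finset.sum_congr rfl h]
  simp

/-- Split a sum over residues modulo `N * K` according to the gcd with `N`. -/
lemma sum_range_mul_eq_sum_divisorsAntidiagonal {M : Type*} [AddCommMonoid M] {N : ℕ}
    (hN : 0 < N) (K : ℕ) (f : ℕ → M) :
    ∑ l ∈ Finset.range (N * K), f l =
      ∑ p ∈ N.divisorsAntidiagonal,
        ∑ i ∈ (Finset.range (p.2 * K)).filter (fun i => i.Coprime p.2), f (p.1 * i) := by
  rw [Finset.sum_sigma']
  symm
  refine Finset.sum_bij' (fun x _ => x.1.1 * x.2)
    (fun l _ => ⟨(l.gcd N, N / l.gcd N), l / l.gcd N⟩) ?_ ?_ ?_ ?_ ?_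
  · rintro ⟨⟨g, e⟩, i⟩ hx
    simp only [Finset.mem_sigma, Nat.mem_divisorsAntidiagonal, Finset.mem_filter,
      Finset.mem_range] at hx ⊢
    obtain ⟨⟨rfl, -⟩, hi, -⟩ := hx
    rw [mul_assoc]
    exact Nat.mul_lt_mul_of_pos_left hi (Nat.pos_of_mul_pos_right hN)
  · intro l hl
    have hg : 0 < l.gcd N := Nat.gcd_pos_of_pos_right _ hN
    simp only [Finset.mem_sigma, Nat.mem_divisorsAntidiagonal, Finset.mem_filter,
      Finset.mem_range] at hl ⊢
    refine ⟨⟨Nat.mul_div_cancel' (Nat.gcd_dvd_right l N), hN.ne'⟩, ?_,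
      Nat.coprime_div_gcd_div_gcd hg⟩
    apply Nat.div_lt_of_lt_mul
    rwa [← mul_assoc, Nat.mul_div_cancel' (Nat.gcd_dvd_right l N)]
  · rintro ⟨⟨g, e⟩, i⟩ hx
    simp only [Finset.mem_sigma, Nat.mem_divisorsAntidiagonal, Finset.mem_filter,
      Finset.mem_range] at hx ⊢
    obtain ⟨⟨rfl, -⟩, -, hi⟩ := hx
    have hg : 0 < g := Nat.pos_of_mul_pos_right hN
    rw [Nat.gcd_mul_left, hi.gcd_eq_one, mul_one, Nat.mul_div_cancel_left _ hg,
      Nat.mul_div_cancel_left _ hg]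
  · intro l _
    exact Nat.mul_div_cancel' (Nat.gcd_dvd_left l N)
  · intros
    rfl

/-- The part of a Dedekind-type sum modulo `e * K` supported on indices coprime to `e`. -/
noncomputable def coprimeDedekindSum (K : ℕ) (e : ℕ) (u : ℤ) : ℝ :=
  ∑ i ∈ (Finset.range (e * K)).filter (fun i => i.Coprime e),
    sawtooth ((i : ℝ) / (e * K)) * sawtooth (u * i / K)

lemma sum_coprimeDedekindSum {K N : ℕ} (hK : 0 < K) (hN : 0 < N) (u : ℤ) :
    ∑ p ∈ N.divisorsAntidiagonal, coprimeDedekindSum K p.2 (p.1 * u) = dedekindSum u K := by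
  have hK' : (K : ℝ) ≠ 0 := by positivity
  have hN' : (N : ℝ) ≠ 0 := by positivity
  have h1 : ∑ p ∈ N.divisorsAntidiagonal, coprimeDedekindSum K p.2 (p.1 * u) =
      ∑ l ∈ Finset.range (N * K), sawtooth ((l : ℝ) / (N * K)) * sawtooth (u * l / K) := by
    rw [sum_range_mul_eq_sum_divisorsAntidiagonal hN]
    refine Finset.sum_congr rfl fun p hp => Finset.sum_congr rfl fun i _ => ?_
    obtain ⟨rfl, -⟩ := Nat.mem_divisorsAntidiagonal.1 hp
    push_cast at hN' ⊢
    obtain ⟨hp1, hp2⟩ := mul_ne_zero_iff.1 hN'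
    congr 2
    · field_simp
    · ring
  rw [h1, sum_range_mul_eq, Finset.sum_comm, dedekindSum, Int.toNat_natCast]
  refine Finset.sum_congr rfl fun r _ => ?_
  have h2 : ∀ t ∈ Finset.range N,
      sawtooth (((r + K * t : ℕ) : ℝ) / (N * K)) * sawtooth (u * (r + K * t : ℕ) / K) =
      sawtooth ((r : ℝ) / (N * K) + t / N) * sawtooth (u * r / K) := by
    intro t _
    rw [← sawtooth_add_int ((u : ℝ) * r / K) (u * t)]
    congr 2 <;> · push_cast; field_simp
  rw [Finset.sum_congr rfl h2, ← Finset.sum_mul, sum_sawtooth_add_div hN]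
  congr 2
  push_cast
  field_simp

lemma sum_dedekindSum_eq {K d : ℕ} (hK : 0 < K) (hd : 0 < d) (u : ℤ) :
    ∑ b ∈ Finset.range d, dedekindSum (u + (b : ℤ) * K) ((d : ℤ) * K) =
      ∑ p ∈ d.divisorsAntidiagonal, (p.1 : ℝ) * coprimeDedekindSum K p.2 u := by
  have hK' : (K : ℝ) ≠ 0 := by positivity
  have hd' : (d : ℝ) ≠ 0 := by positivity
  have ht : ((d : ℤ) * K).toNat = d * K := by
    rw [← Nat.cast_mul, Int.toNat_natCast]
  simp only [dedekindSum, ht]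
  rw [Finset.sum_comm, sum_range_mul_eq_sum_divisorsAntidiagonal hd]
  refine Finset.sum_congr rfl fun p hp => ?_
  obtain ⟨g, e⟩ := p
  obtain ⟨rfl, -⟩ := Nat.mem_divisorsAntidiagonal.1 hp
  dsimp only at *
  push_cast at hd'
  obtain ⟨hg, he⟩ := mul_ne_zero_iff.1 hd'
  rw [coprimeDedekindSum, Finset.mul_sum]
  refine Finset.sum_congr rfl fun i hi => ?_
  have hi := (Finset.mem_filter.1 hi).2
  have h := sum_sawtooth_add_mul_div (g := g) (Nat.pos_of_mul_pos_left hd) hi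
    ((u : ℝ) * i / (e * K))
  rw [← Finset.mul_sum]
  have h2 : (e : ℝ) * ((u : ℝ) * i / (e * K)) = u * i / K := by field_simp
  rw [h2] at h
  rw [mul_left_comm, ← h]
  congr 1
  · congr 1
    push_cast
    field_simp
  · refine Finset.sum_congr rfl fun b _ => ?_
    congr 1
    push_cast
    field_simp

lemma sum_divisorsAntidiagonal_left_comm {M : Type*} [AddCommMonoid M] (n : ℕ)
    (f : ℕ → ℕ → ℕ → M) :
    ∑ p ∈ n.divisorsAntidiagonal, ∑ q ∈ p.2.divisorsAntidiagonal, f p.1 q.1 q.2 =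
      ∑ p ∈ n.divisorsAntidiagonal, ∑ q ∈ p.2.divisorsAntidiagonal, f q.1 p.1 q.2 := by
  have hmem : ∀ x ∈ n.divisorsAntidiagonal.sigma fun p => p.2.divisorsAntidiagonal,
      (⟨(x.2.1, x.1.1 * x.2.2), (x.1.1, x.2.2)⟩ : (_ : ℕ × ℕ) × ℕ × ℕ) ∈
        n.divisorsAntidiagonal.sigma fun p => p.2.divisorsAntidiagonal := by
    rintro ⟨⟨a, d⟩, ⟨g, e⟩⟩ hx
    simp only [Finset.mem_sigma, Nat.mem_divisorsAntidiagonal] at hx ⊢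
    obtain ⟨⟨h1, hn⟩, rfl, -⟩ := hx
    rw [mul_left_comm] at h1
    exact ⟨⟨h1, hn⟩, trivial, right_ne_zero_of_mul (h1.trans_ne hn)⟩
  have hinv : ∀ x ∈ n.divisorsAntidiagonal.sigma fun p => p.2.divisorsAntidiagonal,
      (⟨(x.1.1, x.2.1 * x.2.2), (x.2.1, x.2.2)⟩ : (_ : ℕ × ℕ) × ℕ × ℕ) = x := by
    rintro ⟨⟨a, d⟩, ⟨g, e⟩⟩ hx
    simp only [Finset.mem_sigma, Nat.mem_divisorsAntidiagonal] at hx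
    rw [hx.2.1]
  rw [Finset.sum_sigma', Finset.sum_sigma']
  exact Finset.sum_nbij' _ _ hmem hmem hinv hinv fun _ _ => rfl

/-- Knopp's identity: for integers `h`, `k > 0`, `n > 0`,
`Σ_{ad = n} Σ_{b mod d} s(ah + bk, dk) = σ(n) s(h,k)`. -/
theorem knopp_identity (h k n : ℤ) (hk : 0 < k) (hn : 0 < n) :
    ∑ p ∈ Nat.divisorsAntidiagonal n.toNat, ∑ b ∈ Finset.range p.2,
        dedekindSum ((p.1 : ℤ) * h + (b : ℤ) * k) ((p.2 : ℤ) * k) =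
      (ArithmeticFunction.sigma 1 n.toNat : ℝ) * dedekindSum h k := by
  lift k to ℕ using hk.le
  lift n to ℕ using hn.le
  have hk : 0 < k := by exact_mod_cast hk
  rw [Int.toNat_natCast]
  have pos : ∀ p ∈ n.divisorsAntidiagonal, 0 < p.2 := fun p hp =>
    Nat.pos_of_ne_zero (right_ne_zero_of_mul
      ((Nat.mem_divisorsAntidiagonal.1 hp).1.trans_ne (Nat.mem_divisorsAntidiagonal.1 hp).2))
  rw [Finset.sum_congr rfl fun p hp => sum_dedekindSum_eq hk (pos p hp) (p.1 * h),
    sum_divisorsAntidiagonal_left_comm n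
      (fun a g e => (g : ℝ) * coprimeDedekindSum k e (a * h))]
  simp only [← Finset.mul_sum]
  rw [Finset.sum_congr rfl fun p hp =>
      congrArg ((p.1 : ℝ) * ·) (sum_coprimeDedekindSum hk (pos p hp) h),
    ← Finset.sum_mul, Nat.sum_divisorsAntidiagonal (fun i _ => (i : ℝ)),
    ArithmeticFunction.sigma_one_apply]
  push_cast
  rfl
end
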